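/- Let A ⊆ H be an affine commutative-by-finite Hopf algebra satisfying (OrbSemi). Then: (i) the character component k̂G_H is a Hopf subalgebra of H°; (ii) for all g, h ∈ G_H, ĝ·ĥ ⊆ Σ_{g'∼g, h'∼h} (g'h')^; (iii) each ĝ is a left and right H̄*-module. If in addition A is a domain, then for every g ∈ G_H: (iv) dim_k(ĝ) = |O_{m_g}|·dim_k(H̄); (v) ĝ = ⊕_{h∼g}(H/Hm_h)* = ⊕_{h∼g}(H/m_hH)*. -/

import Mathlib

open TensorProduct LinearMap Coalgebra

namespace Paper

noncomputable section

variable (k : Type) [Field k]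

section Coalg

variable {C : Type} [AddCommMonoid C] [Module k C] [Coalgebra k C]

/-- Convolution product on the linear dual of a coalgebra. -/
noncomputable def conv (f g : Module.Dual k C) : Module.Dual k C :=
  (TensorProduct.lid k k).toLinearMap ∘ₗ TensorProduct.map f g ∘ₗ Coalgebra.comul

/-- The unit of the convolution algebra on the dual: the counit. -/
noncomputable def convOne : Module.Dual k C := Coalgebra.counit

/-- Iterated convolution power. -/
noncomputable def convPow (f : Module.Dual k C) : ℕ → Module.Dual k C
  | 0 => convOne k
  | n + 1 => conv k f (convPow f n)

end Coalg

/-- The finite dual of an algebra: functionals vanishing on a two-sided ideal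
of finite codimension. -/
def finDual (H : Type) [Ring H] [Algebra k H] : Set (Module.Dual k H) :=
  {f | ∃ I : Submodule k H, (∀ (h : H), ∀ x ∈ I, h * x ∈ I ∧ x * h ∈ I) ∧
    I ≤ LinearMap.ker f ∧ FiniteDimensional k (H ⧸ I)}

section Hopf

variable (H : Type) [Ring H] [HopfAlgebra k H]

/-- Left adjoint action `(ad_ℓ h)(a) = Σ h₁ a S(h₂)`. -/
noncomputable def adl (h a : H) : H :=
  TensorProduct.lift (((LinearMap.mul k H).comp (LinearMap.mulRight k a)).compl₂
    (HopfAlgebra.antipode (R := k))) (Coalgebra.comul h)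

/-- Right adjoint action `(ad_r h)(a) = Σ S(h₁) a h₂`. -/
noncomputable def adr (h a : H) : H :=
  TensorProduct.lift ((LinearMap.mul k H).comp ((LinearMap.mulRight k a) ∘ₗ
    (HopfAlgebra.antipode (R := k)))) (Coalgebra.comul h)

/-- Left adjoint action on the dual: `(ad_ℓ φ)(f) = Σ φ₁ f S°(φ₂)`, i.e.
`h ↦ Σ φ(h₁ S(h₃)) f(h₂)`. -/
noncomputable def adld (φ f : Module.Dual k H) : Module.Dual k H :=
  (TensorProduct.lid k k).toLinearMap ∘ₗ
    TensorProduct.map (φ ∘ₗ LinearMap.mul' k H ∘ₗ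
      (HopfAlgebra.antipode (R := k)).lTensor H) f ∘ₗ
    (TensorProduct.assoc k H H H).symm.toLinearMap ∘ₗ
    ((TensorProduct.comm k H H).toLinearMap.lTensor H) ∘ₗ
    ((Coalgebra.comul (R := k) (A := H)).lTensor H) ∘ₗ
    Coalgebra.comul

/-- Right adjoint action on the dual: `(ad_r φ)(f) = Σ S°(φ₁) f φ₂`, i.e.
`h ↦ Σ φ(S(h₁) h₃) f(h₂)`. -/
noncomputable def adrd (φ f : Module.Dual k H) : Module.Dual k H :=
  (TensorProduct.lid k k).toLinearMap ∘ₗ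
    TensorProduct.map (φ ∘ₗ LinearMap.mul' k H ∘ₗ
      (HopfAlgebra.antipode (R := k)).rTensor H) f ∘ₗ
    (TensorProduct.assoc k H H H).symm.toLinearMap ∘ₗ
    ((TensorProduct.comm k H H).toLinearMap.lTensor H) ∘ₗ
    ((Coalgebra.comul (R := k) (A := H)).lTensor H) ∘ₗ
    Coalgebra.comul

/-- A submodule is a subcoalgebra if its image under `comul` lies in `V ⊗ V`. -/
def IsSubcoalgebra (V : Submodule k H) : Prop :=
  ∀ x ∈ V, Coalgebra.comul (R := k) x ∈
    LinearMap.range (TensorProduct.map V.subtype V.subtype)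

/-- A Hopf algebra is pointed if every simple subcoalgebra is one-dimensional. -/
def IsPointedHopf : Prop :=
  ∀ V : Submodule k H, IsSubcoalgebra k H V → V ≠ ⊥ →
    (∀ W : Submodule k H, W ≤ V → IsSubcoalgebra k H W → W = ⊥ ∨ W = V) →
    Module.finrank k ↥V = 1

/-- A coideal: `ε(X) = 0` and `Δ(X) ⊆ X ⊗ H + H ⊗ X`. -/
def IsCoideal (X : Submodule k H) : Prop :=
  (∀ x ∈ X, Coalgebra.counit (R := k) x = 0) ∧
  (∀ x ∈ X, Coalgebra.comul (R := k) x ∈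
    LinearMap.range (TensorProduct.map X.subtype (LinearMap.id (M := H))) ⊔
    LinearMap.range (TensorProduct.map (LinearMap.id (M := H)) X.subtype))

/-- `S` is a Hopf subalgebra of the finite dual `H°` (with its convolution
product; closure under the coproduct is expressed in pairing form). -/
def IsHopfSubalgSet (S : Set (Module.Dual k H)) : Prop :=
  S ⊆ finDual k H ∧ convOne k ∈ S ∧
  (∀ f g, f ∈ S → g ∈ S → f + g ∈ S ∧ conv k f g ∈ S) ∧
  (∀ (c : k), ∀ f ∈ S, c • f ∈ S) ∧
  (∀ f ∈ S, f ∘ₗ HopfAlgebra.antipode (R := k) ∈ S) ∧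
  (∀ f ∈ S, ∃ (n : ℕ) (s t : Fin n → Module.Dual k H),
    (∀ i, s i ∈ S ∧ t i ∈ S) ∧ ∀ x y : H, f (x * y) = ∑ i, s i x * t i y)

end Hopf

section Ext

variable (A : Type) [CommRing A] [HopfAlgebra k A]
variable (H : Type) [Ring H] [HopfAlgebra k H]

/-- The submodule `A⁺H` of `H` (image of the augmentation ideal times `H`). -/
def augHIdeal (ι : A →ₗ[k] H) : Submodule k H :=
  Submodule.span k
    {x : H | ∃ (a : A) (h : H), Coalgebra.counit (R := k) a = 0 ∧ x = ι a * h}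

/-- The subset of the dual of `H` corresponding to `H̄* = (H/A⁺H)*`:
functionals vanishing on `A⁺H`. -/
def hbarStar (ι : A →ₗ[k] H) : Set (Module.Dual k H) :=
  {f | ∀ x ∈ augHIdeal k A H ι, f x = 0}

/-- The tangential component `W(H°)`. -/
def tangential (ι : A →ₗ[k] H) : Set (Module.Dual k H) :=
  {f | f ∈ finDual k H ∧ ∃ n : ℕ, 0 < n ∧ ∀ x ∈ (augHIdeal k A H ι) ^ n, f x = 0}

/-- The augmentation ideal of the commutative Hopf algebra `A`. -/
def augIdeal : Ideal A := RingHom.ker (Bialgebra.counitAlgHom k A)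

/-- The irreducible component `A'` of `A°` containing the counit:
functionals vanishing on a power of the augmentation ideal. -/
def Aprime : Set (Module.Dual k A) :=
  {f | ∃ n : ℕ, 0 < n ∧ ∀ x ∈ (augIdeal k A) ^ n, f x = 0}

/-- The Lie algebra `𝔤` of `G_H`: primitive functionals on `A`. -/
def gLie : Set (Module.Dual k A) :=
  {f | f 1 = 0 ∧ ∀ x y : A, f (x * y) =
    f x * Coalgebra.counit (R := k) y + Coalgebra.counit (R := k) x * f y}

/-- An ideal of `A` is `H̄`-stable if it is stable under the (left) adjoint
action of `H` on `A` (which factors through `H̄`). -/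
def IsHStable (ι : A →ₗ[k] H) (I : Ideal A) : Prop :=
  ∀ (h : H), ∀ a ∈ I, ∃ b ∈ I, ι b = adl k H h (ι a)

/-- `mc` is the `H̄`-core of `m`: the largest `H̄`-stable ideal of `A`
contained in `m`. -/
def IsCore (ι : A →ₗ[k] H) (m mc : Ideal A) : Prop :=
  IsHStable k A H ι mc ∧ mc ≤ m ∧
    ∀ I : Ideal A, IsHStable k A H ι I → I ≤ m → I ≤ mc

/-- The submodule `H·J` of `H`, for an ideal `J` of `A`. -/
def leftMul (ι : A →ₗ[k] H) (J : Ideal A) : Submodule k H :=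
  Submodule.span k {x : H | ∃ (h : H), ∃ a ∈ J, x = h * ι a}

/-- The submodule `J·H` of `H`, for an ideal `J` of `A`. -/
def rightMul (ι : A →ₗ[k] H) (J : Ideal A) : Submodule k H :=
  Submodule.span k {x : H | ∃ (h : H), ∃ a ∈ J, x = ι a * h}

/-- The subcoalgebra `ĝ := (H/H m_g^{(H̄)})*` of `H°`, as a submodule of the dual. -/
def ghat (ι : A →ₗ[k] H) (core : Ideal A → Ideal A) (g : A →ₐ[k] k) :
    Submodule k (Module.Dual k H) :=
  (leftMul k A H ι (core (RingHom.ker g))).dualAnnihilator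

/-- The character component `k̂G_H` of `H°`. -/
def charComp (ι : A →ₗ[k] H) (core : Ideal A → Ideal A) :
    Set (Module.Dual k H) :=
  {f | ∃ s : Finset (A →ₐ[k] k), s.Nonempty ∧
    ∀ x ∈ ⨅ g ∈ s, leftMul k A H ι (core (RingHom.ker g)), f x = 0}

/-- Hypothesis (OrbSemi): all orbit algebras `A/m^{(H̄)}` are semisimple. -/
def OrbSemi (core : Ideal A → Ideal A) : Prop :=
  ∀ m : Ideal A, m.IsMaximal → IsSemisimpleRing (A ⧸ core m)

/-- Restriction of functionals along `ι` : the map `ι° : H° → A°`. -/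
def iotaDual (ι : A →ₗ[k] H) (f : Module.Dual k H) : Module.Dual k A := f ∘ₗ ι

/-- Coextension of functionals along the projection `Π : H → A`:
the map `Π° : A° → H°`. -/
def PiDual (p : H →ₗ[k] A) (α : Module.Dual k A) : Module.Dual k H := α ∘ₗ p

/-- `A ⊆ H` is an affine commutative-by-finite Hopf algebra, where the
inclusion of the commutative normal Hopf subalgebra `A` is recorded by the
injective Hopf algebra map `ι`. -/
structure CommByFinite (ι : A →ₗ[k] H) : Prop where
  ι_inj : Function.Injective ι
  ι_one : ι 1 = 1
  ι_mul : ∀ a b : A, ι (a * b) = ι a * ι b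
  ι_comul : ∀ a : A,
    Coalgebra.comul (R := k) (ι a) = TensorProduct.map ι ι (Coalgebra.comul a)
  ι_counit : ∀ a : A,
    Coalgebra.counit (R := k) (ι a) = Coalgebra.counit (R := k) a
  ι_antipode : ∀ a : A,
    ι (HopfAlgebra.antipode (R := k) a) = HopfAlgebra.antipode (R := k) (ι a)
  affine : ∃ s : Finset A, Algebra.adjoin k (s : Set A) = ⊤
  normal_left : ∀ (h : H) (a : A), adl k H h (ι a) ∈ Set.range ι
  normal_right : ∀ (h : H) (a : A), adr k H h (ι a) ∈ Set.range ι
  finiteOver : ∃ s : Finset H,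
    Submodule.span k {x : H | ∃ (a : A), ∃ y ∈ s, x = ι a * y} = ⊤

/-- The standing hypothesis: `A` is semiprime (reduced) or central in `H`,
or `H` is pointed. -/
def StandingHyp (ι : A →ₗ[k] H) : Prop :=
  IsReduced A ∨ (∀ (a : A) (h : H), ι a * h = h * ι a) ∨ IsPointedHopf k H

/-- `Π : H → A` is the projection of a direct sum decomposition
`H = A ⊕ X` of right `A`-modules. -/
structure IsSplitting (ι : A →ₗ[k] H) (p : H →ₗ[k] A) : Prop where
  left_inv : ∀ a : A, p (ι a) = a
  right_linear : ∀ (h : H) (a : A), p (h * ι a) = p h * a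

/-- Hypothesis (CoSplit) for a given splitting `Π`: the complement
`X = ker Π` is a coideal of `H`. -/
def CoSplit (p : H →ₗ[k] A) : Prop := IsCoideal k H (LinearMap.ker p)

end Ext

section Quot

variable (A : Type) [CommRing A] [HopfAlgebra k A]
variable (H : Type) [Ring H] [HopfAlgebra k H]
variable (Hb : Type) [Ring Hb] [HopfAlgebra k Hb]

/-- `π : H → H̄` realises `H̄` as the quotient Hopf algebra `H/A⁺H`. -/
structure IsHbarQuotient (ι : A →ₗ[k] H) (π : H →ₗ[k] Hb) : Prop where
  π_surj : Function.Surjective π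
  π_one : π 1 = 1
  π_mul : ∀ x y : H, π (x * y) = π x * π y
  π_comul : ∀ x : H,
    Coalgebra.comul (R := k) (π x) = TensorProduct.map π π (Coalgebra.comul x)
  π_counit : ∀ x : H,
    Coalgebra.counit (R := k) (π x) = Coalgebra.counit (R := k) x
  π_antipode : ∀ x : H,
    π (HopfAlgebra.antipode (R := k) x) = HopfAlgebra.antipode (R := k) (π x)
  π_ker : LinearMap.ker π = augHIdeal k A H ι
  findim : FiniteDimensional k Hb

/-- Composition with `π` : the map `π° : H̄* → H°`. -/
def piDual (π : H →ₗ[k] Hb) (β : Module.Dual k Hb) : Module.Dual k H := β ∘ₗ π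

end Quot

end

end Paper

open TensorProduct LinearMap Coalgebra

namespace Paper

noncomputable section

section SW
variable {k : Type} [Field k]
variable {H : Type} [Ring H] [HopfAlgebra k H]
variable {M : Type} [AddCommGroup M] [Module k M]

variable (k) in
/-- Sweedler sum. -/
def sw (F : H → H → M) (h : H) : M :=
  ∑ i ∈ (ℛ k h).index, F ((ℛ k h).left i) ((ℛ k h).right i)

variable (k) in
structure Bil (F : H → H → M) : Prop where
  l : ∀ y, IsLinearMap k (fun x => F x y)
  r : ∀ x, IsLinearMap k (fun y => F x y)

variable (k) in
structure Tri (F : H → H → H → M) : Prop where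
  a : ∀ y z, IsLinearMap k (fun x => F x y z)
  b : ∀ x z, IsLinearMap k (fun y => F x y z)
  c : ∀ x y, IsLinearMap k (fun z => F x y z)

def Bil.mk2 {F : H → H → M} (hF : Bil k F) : H →ₗ[k] H →ₗ[k] M :=
  LinearMap.mk₂ k F (fun a b c => (hF.l c).map_add a b) (fun a b c => (hF.l c).map_smul a b)
    (fun a b c => (hF.r a).map_add b c) (fun a b c => (hF.r b).map_smul a c)

theorem sw_eq_lift {F : H → H → M} (hF : Bil k F) (h : H) :
    sw k F h = TensorProduct.lift hF.mk2 (comul h) := by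
  conv_rhs => rw [← (ℛ k h).eq]
  simp [sw, Bil.mk2]

theorem sw_repr {F : H → H → M} (hF : Bil k F) (h : H) {ι : Type*} (r : Coalgebra.Repr k h ι) :
    sw k F h = ∑ i ∈ r.index, F (r.left i) (r.right i) := by
  rw [sw_eq_lift hF, ← r.eq]
  simp [Bil.mk2]

theorem sw_lin {F : H → H → M} (hF : Bil k F) : IsLinearMap k (sw k F) := by
  constructor
  · intro x y; simp only [sw_eq_lift hF, map_add]
  · intro x y; simp only [sw_eq_lift hF, map_smul]

theorem sw_congr {F G : H → H → M} (h : ∀ x y, F x y = G x y) (x : H) : sw k F x = sw k G x := by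
  have : F = G := by ext x y; exact h x y
  rw [this]

theorem map_sw {N : Type} [AddCommGroup N] [Module k N] (L : M →ₗ[k] N) (F : H → H → M) (h : H) :
    L (sw k F h) = sw k (fun x y => L (F x y)) h := by
  simp [sw]

theorem sw_mul_right (F : H → H → H) (h z : H) :
    sw k F h * z = sw k (fun x y => F x y * z) h := by
  simp [sw, Finset.sum_mul]

theorem sw_mul_left (F : H → H → H) (h z : H) :
    z * sw k F h = sw k (fun x y => z * F x y) h := by
  simp [sw, Finset.mul_sum]

theorem sw_smul (c : k) (F : H → H → M) (h : H) :
    c • sw k F h = sw k (fun x y => c • F x y) h := by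
  simp [sw, Finset.smul_sum]

theorem sw_mem (P : Submodule k M) (F : H → H → M) (h : H) (hF : ∀ x y, F x y ∈ P) :
    sw k F h ∈ P := Submodule.sum_mem _ fun _ _ => hF _ _

theorem sw_coassoc {F : H → H → H → M} (hF : Tri k F) (h : H) :
    sw k (fun x y => sw k (fun u v => F u v y) x) h =
    sw k (fun x y => sw k (fun u v => F x u v) y) h := by
  have e := sum_tmul_tmul_eq (ℛ k h) (fun i => ℛ k ((ℛ k h).left i))
    (fun i => ℛ k ((ℛ k h).right i))
  let L : H →ₗ[k] H →ₗ[k] H →ₗ[k] M :=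
    LinearMap.mk₂ k (fun x y => (hF.c x y).mk' _)
      (fun a b c => by ext z; exact (hF.a c z).map_add a b)
      (fun a b c => by ext z; exact (hF.a c z).map_smul a b)
      (fun a b c => by ext z; exact (hF.b a z).map_add b c)
      (fun a b c => by ext z; exact (hF.b b z).map_smul a c)
  have e2 := congrArg (TensorProduct.lift (TensorProduct.lift L) ∘ₗ
    (TensorProduct.assoc k H H H).symm.toLinearMap) e
  simpa [sw, L] using e2

theorem sw_counit_left {G : H → M} (hG : IsLinearMap k G) (h : H) :
    sw k (fun x y => counit (R := k) x • G y) h = G h := by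
  have := congrArg (hG.mk' G) (sum_counit_smul (ℛ k h))
  simpa [sw] using this

theorem sw_counit_right {G : H → M} (hG : IsLinearMap k G) (h : H) :
    sw k (fun x y => counit (R := k) y • G x) h = G h := by
  have := congrArg (TensorProduct.lift ((LinearMap.lsmul k M).flip ∘ₗ (hG.mk' G))) (sum_tmul_counit_eq (ℛ k h))
  rw [map_sum] at this
  simpa only [sw, TensorProduct.lift.tmul, LinearMap.comp_apply, LinearMap.flip_apply,
    LinearMap.lsmul_apply, IsLinearMap.mk'_apply, one_smul] using this

theorem sw_S_left {G : H → M} (hG : IsLinearMap k G) (h : H) :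
    sw k (fun x y => G (HopfAlgebra.antipode k x * y)) h = counit (R := k) h • G 1 := by
  have := congrArg (hG.mk' G) (HopfAlgebra.sum_antipode_mul_eq_smul (ℛ k h))
  simpa [sw] using this

theorem sw_S_right {G : H → M} (hG : IsLinearMap k G) (h : H) :
    sw k (fun x y => G (x * HopfAlgebra.antipode k y)) h = counit (R := k) h • G 1 := by
  have := congrArg (hG.mk' G) (HopfAlgebra.sum_mul_antipode_eq_smul (ℛ k h))
  simpa [sw] using this

theorem sw_mul {F : H → H → M} (hF : Bil k F) (x y : H) :
    sw k F (x * y) = sw k (fun x₁ x₂ => sw k (fun y₁ y₂ => F (x₁ * y₁) (x₂ * y₂)) y) x := by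
  rw [sw_repr hF (x * y) ((ℛ k x).mul (ℛ k y))]
  simp [sw, Finset.sum_product]

theorem sw_one {F : H → H → M} (hF : Bil k F) : sw k F 1 = F 1 1 := by
  rw [sw_eq_lift hF]; simp [Bil.mk2, Algebra.TensorProduct.one_def]

theorem conv_eq_sw (f g : Module.Dual k H) (h : H) : 
    conv k f g h = sw k (fun x y => f x * g y) h := by
  simp only [conv, LinearMap.comp_apply]
  rw [← (ℛ k h).eq]
  simp [sw]

theorem adl_eq_sw (h a : H) : 
    adl k H h a = sw k (fun x y => x * a * HopfAlgebra.antipode k y) h := by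
  rw [adl, ← (ℛ k h).eq]
  simp [sw]

abbrev lin {G : H → M} (h1 : ∀ x y, G (x + y) = G x + G y) (h2 : ∀ (c : k) x, G (c • x) = c • G x) :
   IsLinearMap k G := ⟨h1, h2⟩

-- h a = Σ (h₁·a) h₂
theorem mul_eq_sw_adl (h a : H) : h * a = sw k (fun x y => adl k H x a * y) h := by
  simp only [adl_eq_sw, sw_mul_right]
  rw [sw_coassoc (F := fun u v y => u * a * HopfAlgebra.antipode k v * y)]
  · have : ∀ x y : H, sw k (fun u v => x * a * HopfAlgebra.antipode k u * v) y 
       = counit (R := k) y • (x * a) := by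
      intro x y
      have := sw_S_left (k := k) (G := fun z => x * a * z) ⟨by simp [mul_add], by simp⟩ y
      simpa [mul_assoc] using this
    simp only [this]
    rw [sw_counit_right (G := fun x => x * a)]
    exact ⟨by simp [add_mul], by simp⟩
  · constructor <;> intros <;> constructor <;> intros <;> simp [add_mul, mul_add]

theorem adl_add_left (x y a : H) : adl k H (x + y) a = adl k H x a + adl k H y a := by
  simp [adl]

theorem adl_smul_left (c : k) (x a : H) : adl k H (c • x) a = c • adl k H x a := by
  simp [adl]

theorem adl_add_right (x a b : H) : adl k H x (a + b) = adl k H x a + adl k H x b := by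
  simp [adl_eq_sw, sw, mul_add, add_mul, Finset.sum_add_distrib]

theorem adl_smul_right (c : k) (x a : H) : adl k H x (c • a) = c • adl k H x a := by
  simp [adl_eq_sw, sw, Finset.smul_sum]

theorem adl_one_left (a : H) : adl k H 1 a = a := by
  rw [adl_eq_sw, sw_one]
  · simp
  · constructor <;> intros <;> constructor <;> intros <;> simp [add_mul, mul_add]

theorem adl_mul_left (x y a : H) : adl k H (x * y) a = adl k H x (adl k H y a) := by
  rw [adl_eq_sw, sw_mul, adl_eq_sw]
  · simp only [adl_eq_sw, sw_mul_right, sw_mul_left, HopfAlgebra.antipode_mul_antidistrib,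
      mul_assoc]
  · constructor <;> intros <;> constructor <;> intros <;> simp [add_mul, mul_add]

-- Σ S(y₁) (y₂·b) = b S(y)
theorem sw_S_adl (y b : H) :
    sw k (fun u v => HopfAlgebra.antipode k u * adl k H v b) y = b * HopfAlgebra.antipode k y := by
  simp only [adl_eq_sw, sw_mul_left]
  rw [← sw_coassoc (F := fun u v z =>
    HopfAlgebra.antipode k u * (v * b * HopfAlgebra.antipode k z))]
  · have : ∀ x z : H, sw k (fun u v => HopfAlgebra.antipode k u *
        (v * b * HopfAlgebra.antipode k z)) x
        = counit (R := k) x • (b * HopfAlgebra.antipode k z) := by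
      intro x z
      have := sw_S_left (k := k) (G := fun w => w * (b * HopfAlgebra.antipode k z))
        ⟨by simp [add_mul], by simp⟩ x
      simpa [mul_assoc] using this
    simp only [this]
    rw [sw_counit_left (G := fun z => b * HopfAlgebra.antipode k z)]
    exact ⟨by simp [mul_add], by simp⟩
  · constructor <;> intros <;> constructor <;> intros <;> simp [add_mul, mul_add]

theorem adl_mul_right (h a b : H) :
    adl k H h (a * b) = sw k (fun x y => adl k H x a * adl k H y b) h := by
  have e : ∀ x y : H, adl k H x a * adl k H y b =
      sw k (fun u v => u * a * HopfAlgebra.antipode k v * adl k H y b) x := by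
    intro x y
    rw [adl_eq_sw x a, sw_mul_right]
  simp only [e]
  rw [sw_coassoc (F := fun u v y => u * a * HopfAlgebra.antipode k v * adl k H y b)]
  · rw [adl_eq_sw]
    apply sw_congr
    intro x y
    have := sw_S_adl (k := k) y b
    simp only [mul_assoc, ← sw_mul_left, this]
  · constructor <;> intros <;> constructor <;> intros <;>
      simp [add_mul, mul_add, adl_add_left, adl_smul_left]

theorem adl_bil_mul (a b : H) : Bil k (fun x y => adl k H x a * adl k H y b) := by
  constructor <;> intros <;> constructor <;> intros <;>
      simp [add_mul, mul_add, adl_add_left, adl_smul_left]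

-- (h·a) x = Σ h₁·(a (S(h₂)·x))
theorem adl_mul_eq (h a b : H) :
    adl k H h a * b = sw k (fun x y => adl k H x (a * adl k H (HopfAlgebra.antipode k y) b)) h := by
  simp only [adl_mul_right]
  rw [sw_coassoc (F := fun u v y => adl k H u a * adl k H v (adl k H (HopfAlgebra.antipode k y) b))]
  · have : ∀ x y : H, sw k (fun u v => adl k H x a *
        adl k H u (adl k H (HopfAlgebra.antipode k v) b)) y
        = counit (R := k) y • (adl k H x a * b) := by
      intro x y
      have := sw_S_right (k := k) (G := fun w => adl k H x a * adl k H w b)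
        ⟨by simp [adl_add_left, mul_add], by simp [adl_smul_left]⟩ y
      simpa [adl_mul_left, adl_one_left] using this
    simp only [this]
    rw [sw_counit_right (G := fun x => adl k H x a * b)]
    exact ⟨by simp [adl_add_left, add_mul], by simp [adl_smul_left]⟩
  · constructor <;> intros <;> constructor <;> intros <;>
      simp [add_mul, mul_add, adl_add_left, adl_smul_left, adl_add_right, adl_smul_right]

end SW
end
end Paper


open TensorProduct LinearMap Coalgebra

namespace Paper

noncomputable section

set_option linter.all false
set_option linter.unusedSectionVars false
section Integral
variable {k : Type} [Field k]
variable {B : Type} [Ring B] [HopfAlgebra k B]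
variable {M : Type} [AddCommGroup M] [Module k M]

local notation "S" => HopfAlgebra.antipode k (A := B)

theorem sw_add (F G : B → B → M) (h : B) :
    sw k (fun x y => F x y + G x y) h = sw k F h + sw k G h := by
  simp [sw, Finset.sum_add_distrib]

theorem sw_sum {ι : Type} (s : Finset ι) (F : ι → B → B → M) (h : B) :
    sw k (fun x y => ∑ i ∈ s, F i x y) h = ∑ i ∈ s, sw k (F i) h := by
  simp only [sw]; exact Finset.sum_comm

theorem basis_shift {n : ℕ} (b : Module.Basis (Fin n) k B) (φ : B →ₗ[k] B)
    (G : B → Module.Dual k B → M) (h1 : ∀ f, IsLinearMap k (fun u => G u f))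
    (h2 : ∀ u, IsLinearMap k (G u)) :
    ∑ i, G (φ (b i)) (b.coord i) = ∑ i, G (b i) (b.coord i ∘ₗ φ) := by
  have e1 : ∀ i, G (φ (b i)) (b.coord i) = ∑ j, b.coord j (φ (b i)) • G (b j) (b.coord i) := by
    intro i
    conv_lhs => rw [← b.sum_repr (φ (b i))]
    have := map_sum ((h1 (b.coord i)).mk' _) (fun j => b.repr (φ (b i)) j • b j) Finset.univ
    simp only [map_smul, IsLinearMap.mk'_apply] at this
    simpa using this
  have e2 : ∀ i, G (b i) (b.coord i ∘ₗ φ) = ∑ j, b.coord i (φ (b j)) • G (b i) (b.coord j) := by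
    intro i
    have : b.coord i ∘ₗ φ = ∑ j, b.coord i (φ (b j)) • b.coord j := by
      apply b.ext
      intro l
      simp [Finsupp.single_apply]
    conv_lhs => rw [this]
    have := map_sum ((h2 (b i)).mk' _) (fun j => b.coord i (φ (b j)) • b.coord j) Finset.univ
    simp only [map_smul, IsLinearMap.mk'_apply] at this
    simpa using this
  simp only [e1, e2]
  exact Finset.sum_comm

theorem exists_integral [FiniteDimensional k B] [Nontrivial B] :
    ∃ Λ : B, Λ ≠ 0 ∧ ∀ x : B, x * Λ = counit (R := k) x • Λ := by
  classical
  let b := Module.finBasis k B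
  let L : B → B := fun z => ∑ i, sw k (fun u v => b.coord i (S (S v) * z) • u) (b i)
  have hint : ∀ z x, x * L z = counit (R := k) x • L z := by
    intro z x
    let G : B → B → Module.Dual k B → B := fun q u f =>
      sw k (fun u1 u2 => f (S q * (S (S u2) * z)) • u1) u
    have key : ∀ (f : Module.Dual k B) (e : B),
        sw k (fun u v => f (S (S v) * z) • (x * u)) e = sw k (fun p q => G q (p * e) f) x := by
      intro f e
      simp only [G]
      have e1 : ∀ p q : B, sw k (fun u1 u2 => f (S q * (S (S u2) * z)) • u1) (p * e)
         = sw k (fun p1 p2 => sw k (fun e1 e2 => f (S (S p2 * q) * (S (S e2) * z)) • (p1 * e1)) e)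
            p := by
        intro p q
        rw [sw_mul]
        · simp only [HopfAlgebra.antipode_mul_antidistrib, mul_assoc]
        · constructor <;> intros <;> constructor <;> intros <;>
            simp [add_mul, mul_add, add_smul, smul_smul, mul_comm]
      simp only [e1]
      rw [sw_coassoc (F := fun p1 p2 q => 
        sw k (fun e1 e2 => f (S (S p2 * q) * (S (S e2) * z)) • (p1 * e1)) e)]
      · have e2 : ∀ p1 y : B, sw k (fun p2 q => 
            sw k (fun e1 e2 => f (S (S p2 * q) * (S (S e2) * z)) • (p1 * e1)) e) y
            = counit (R := k) y • sw k (fun e1 e2 => f (S (S e2) * z) • (p1 * e1)) e := by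
          intro p1 y
          rw [sw_S_left (G := fun w => sw k (fun e1 e2 => f (S w * (S (S e2) * z)) • (p1 * e1)) e)]
          · simp
          · constructor <;> intros <;> simp [add_mul, add_smul, sw_add, sw_smul, mul_smul]
        simp only [e2]
        rw [sw_counit_right (G := fun p1 => sw k (fun e1 e2 => f (S (S e2) * z) • (p1 * e1)) e)]
        constructor <;> intros <;> simp [add_mul, sw_add, sw_smul, smul_smul, mul_comm]
      · constructor <;> intros <;> constructor <;> intros <;>
          simp [add_mul, mul_add, add_smul, sw_add, sw_smul, smul_smul, mul_comm]
    have e3 : x * L z = sw k (fun p q => ∑ i, G q (p * b i) (b.coord i)) x := by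
      simp only [L, Finset.mul_sum, sw_mul_left, sw_sum, ← key, mul_smul_comm]
    rw [e3]
    have e4 : ∀ p q, ∑ i, G q (p * b i) (b.coord i) =
       ∑ i, G q (b i) (b.coord i ∘ₗ LinearMap.mulLeft k p) := by
      intro p q
      apply basis_shift b (LinearMap.mulLeft k p) (G q)
      · intro f
        apply sw_lin
        constructor <;> intros <;> constructor <;> intros <;>
            simp [add_mul, mul_add, add_smul, smul_smul, mul_comm]
      · intro u
        constructor <;> intros <;> simp [G, add_smul, sw_add, sw_smul, mul_smul]
    simp only [e4, sw_sum, L, Finset.smul_sum]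
    refine Finset.sum_congr rfl fun i _ => ?_
    simp only [G, LinearMap.comp_apply, LinearMap.mulLeft_apply, ← mul_assoc]
    rw [sw_S_right (G := fun w => sw k (fun u1 u2 => b.coord i (w * S (S u2) * z) • u1) (b i))]
    · simp
    · constructor <;> intros <;> simp [add_mul, add_smul, sw_add, sw_smul, mul_smul]
  by_contra hcon
  push Not at hcon
  have hL : ∀ z, L z = 0 := by
    intro z
    by_contra h0
    obtain ⟨x, hx⟩ := hcon _ h0
    exact hx (hint z x)
  obtain ⟨z', hz'⟩ := exists_ne (0 : B)
  apply hz'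
  have f1 : ∀ j z, ∑ i, sw k (fun u v => sw k (fun p q =>
      (b.coord i (S (S v) * z) * b.coord j q) • p) u) (b i) = 0 := by
    intro j z
    have hb : Bil k (fun p q : B => b.coord j q • p) := by
      constructor <;> intros <;> constructor <;> intros <;>
            simp [add_smul, smul_smul, mul_comm]
    have := congrArg ((sw_lin hb).mk' _) (hL z)
    simp only [L, map_sum, map_zero, map_sw, map_smul, IsLinearMap.mk'_apply, sw_smul,
      smul_smul] at this
    exact this
  have f2 : ∑ j, ∑ i, sw k (fun u v => sw k (fun p q =>
      (b.coord i (S (S v) * (S (b j) * z')) * b.coord j q) • p) u) (b i) = 0 :=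
    Finset.sum_eq_zero fun j _ => f1 j _
  rw [Finset.sum_comm] at f2
  have f3 : ∀ i, ∑ j, sw k (fun u v => sw k (fun p q =>
      (b.coord i (S (S v) * (S (b j) * z')) * b.coord j q) • p) u) (b i) = b.coord i z' • b i := by
    intro i
    simp only [← sw_sum, ← Finset.sum_smul]
    have : ∀ q v : B, ∑ j, b.coord i (S (S v) * (S (b j) * z')) * b.coord j q =
       b.coord i (S (q * S v) * z') := by
      intro q v
      rw [HopfAlgebra.antipode_mul_antidistrib]
      let G : B →ₗ[k] k := b.coord i ∘ₗ LinearMap.mulLeft k (S (S v)) ∘ₗ LinearMap.mulRight k z' ∘ₗ S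
      have := congrArg G (b.sum_repr q)
      simp only [map_sum, map_smul] at this
      simpa only [G, LinearMap.comp_apply, LinearMap.mulLeft_apply, LinearMap.mulRight_apply,
        smul_eq_mul, mul_assoc, mul_comm, Module.Basis.coord_apply] using this
    simp only [this]
    rw [sw_coassoc (F := fun p q v => b.coord i (S (q * S v) * z') • p)]
    · have g : ∀ p r : B, sw k (fun q v => b.coord i (S (q * S v) * z') • p) r =
        counit (R := k) r • (b.coord i z' • p) := by
        intro p r
        rw [sw_S_right (G := fun w => b.coord i (S w * z') • p)]
        · simp
        · constructor <;> intros <;> simp [add_mul, add_smul, mul_smul]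
      simp only [g]
      rw [sw_counit_right (G := fun p => b.coord i z' • p)]
      constructor <;> intros <;> simp [smul_smul, mul_comm]
    · constructor <;> intros <;> constructor <;> intros <;>
            simp [add_smul, smul_smul, mul_comm, add_mul, mul_add]
  simp only [f3] at f2
  rw [← f2]
  exact (b.sum_repr z').symm

theorem antipode_injective [FiniteDimensional k B] [Nontrivial B] :
    Function.Injective (HopfAlgebra.antipode k (A := B)) := by
  classical
  rw [injective_iff_map_eq_zero]
  obtain ⟨Λ, hΛ, hint⟩ := exists_integral (k := k) (B := B)
  have id1 : ∀ (f : Module.Dual k B) (h : B),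
      sw k (fun u v => f u • (h * v)) Λ = sw k (fun u v => f (S h * u) • v) Λ := by
    intro f h
    have hb : ∀ p : B, Bil k (fun u v : B => f (S p * u) • v) := by
      intro p
      constructor <;> intros <;> constructor <;> intros <;>
            simp [add_smul, smul_smul, mul_comm, mul_add]
    have r1 : sw k (fun p r => sw k (fun u v => f (S p * u) • v) (r * Λ)) h =
       sw k (fun u v => f (S h * u) • v) Λ := by
      have : ∀ p r : B, sw k (fun u v => f (S p * u) • v) (r * Λ) = 
        counit (R := k) r • sw k (fun u v => f (S p * u) • v) Λ := by
        intro p r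
        rw [hint, (sw_lin (hb p)).map_smul]
      simp only [this]
      rw [sw_counit_right (G := fun p => sw k (fun u v => f (S p * u) • v) Λ)]
      constructor <;> intros <;> simp [add_mul, add_smul, sw_add, sw_smul, mul_smul]
    rw [← r1]
    have r2 : ∀ p r : B, sw k (fun u v => f (S p * u) • v) (r * Λ) =
        sw k (fun r1 r2 => sw k (fun u v => f (S p * r1 * u) • (r2 * v)) Λ) r := by
      intro p r
      rw [sw_mul (hb p)]
      simp only [mul_assoc]
    simp only [r2]
    rw [← sw_coassoc (F := fun p r1 r2 => sw k (fun u v => f (S p * r1 * u) • (r2 * v)) Λ)]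
    · have : ∀ y r2 : B, sw k (fun p r1 => sw k (fun u v => f (S p * r1 * u) • (r2 * v)) Λ) y =
         counit (R := k) y • sw k (fun u v => f u • (r2 * v)) Λ := by
        intro y r2
        rw [sw_S_left (G := fun w => sw k (fun u v => f (w * u) • (r2 * v)) Λ)]
        · simp
        · constructor <;> intros <;> simp [add_mul, add_smul, sw_add, sw_smul, mul_smul]
      simp only [this]
      rw [sw_counit_left (G := fun r2 => sw k (fun u v => f u • (r2 * v)) Λ)]
      constructor <;> intros <;> simp [add_mul, sw_add, sw_smul, smul_smul, mul_comm]
    · constructor <;> intros <;> constructor <;> intros <;>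
            simp [add_smul, smul_smul, mul_comm, add_mul, mul_add, sw_add, sw_smul]
  intro h hh
  have id2 : ∀ (f : Module.Dual k B) (x : B), sw k (fun u v => f u • (h * x * v)) Λ = 0 := by
    intro f x
    rw [id1, HopfAlgebra.antipode_mul_antidistrib, hh]
    simp [sw]
  obtain ⟨f, hf⟩ : ∃ f : Module.Dual k B, f Λ = 1 := by
    by_contra hc
    apply hΛ
    rw [← Module.forall_dual_apply_eq_zero_iff k Λ]
    intro f
    by_contra h0
    exact hc ⟨(f Λ)⁻¹ • f, by simp [h0]⟩
  let b := Module.finBasis k B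
  have id3 : sw k (fun u v => sw k (fun p q => f u • (h * S p * q)) v) Λ = h := by
    have : ∀ u v : B, sw k (fun p q => f u • (h * S p * q)) v = counit (R := k) v • (f u • h) := by
      intro u v
      have := sw_S_left (k := k) (G := fun w => f u • (h * w)) (by
        constructor <;> intros <;> simp [mul_add, smul_smul, mul_comm]) v
      simpa [mul_assoc] using this
    simp only [this]
    rw [sw_counit_right (G := fun u => f u • h)]
    · simp [hf]
    · constructor <;> intros <;> simp [add_smul, mul_smul]
  rw [← id3, ← sw_coassoc (F := fun u p q => f u • (h * S p * q))]
  · have : ∀ u v : B, sw k (fun p q => f p • (h * S q * v)) u =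
      ∑ j, sw k (fun p q => f p * b.coord j q) u • (h * S (b j) * v) := by
      intro u v
      have e : ∀ j, sw k (fun p q => f p * b.coord j q) u • (h * S (b j) * v) =
         sw k (fun p q => (f p * b.coord j q) • (h * S (b j) * v)) u := by
        intro j
        simp [sw, Finset.sum_smul]
      simp only [e, ← sw_sum]
      apply sw_congr
      intro p q
      let G : B →ₗ[k] B := f p • (LinearMap.mulRight k v ∘ₗ LinearMap.mulLeft k h ∘ₗ S)
      have := congrArg G (b.sum_repr q)
      simp only [map_sum, map_smul] at this
      simp only [G, LinearMap.comp_apply, LinearMap.mulLeft_apply, LinearMap.mulRight_apply,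
        LinearMap.smul_apply] at this
      rw [← this]
      refine Finset.sum_congr rfl fun j _ => ?_
      rw [smul_smul, mul_comm]; rfl
    simp only [this, sw_sum]
    refine Finset.sum_eq_zero fun j _ => ?_
    have hb : Bil k (fun p q : B => f p * b.coord j q) := by
      constructor <;> intros <;> constructor <;> intros <;>
            simp [add_mul, mul_add, mul_assoc, mul_left_comm]
    exact id2 ((sw_lin hb).mk' _) (S (b j))
  · constructor <;> intros <;> constructor <;> intros <;>
            simp [add_smul, smul_smul, mul_comm, add_mul, mul_add]

end Integral
end
end Paper


open TensorProduct LinearMap Coalgebra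

namespace Paper

noncomputable section
set_option linter.all false
set_option linter.unusedSectionVars false
section Act
variable {k : Type} [Field k]
variable {A : Type} [CommRing A] [HopfAlgebra k A]
variable {H : Type} [Ring H] [HopfAlgebra k H]
variable {ι : A →ₗ[k] H} (hC : CommByFinite k A H ι)
variable {M : Type} [AddCommGroup M] [Module k M]

theorem sw_iota (hC : CommByFinite k A H ι) {F : H → H → M} (hF : Bil k F) (b : A) :
    sw k F (ι b) = sw k (fun x y => F (ι x) (ι y)) b := by
  rw [sw_eq_lift hF, hC.ι_comul]
  conv_lhs => rw [← (ℛ k b).eq]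
  simp [sw, Bil.mk2]

def act (h : H) (a : A) : A := (hC.normal_left h a).choose

theorem iota_act (h : H) (a : A) : ι (act hC h a) = adl k H h (ι a) :=
  (hC.normal_left h a).choose_spec

theorem act_add_left (x y : H) (a : A) : act hC (x + y) a = act hC x a + act hC y a :=
  hC.ι_inj (by simp [iota_act, adl_add_left])
theorem act_smul_left (c : k) (x : H) (a : A) : act hC (c • x) a = c • act hC x a :=
  hC.ι_inj (by simp [iota_act, adl_smul_left])
theorem act_add_right (x : H) (a b : A) : act hC x (a + b) = act hC x a + act hC x b :=
  hC.ι_inj (by simp [iota_act, adl_add_right])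
theorem act_smul_right (c : k) (x : H) (a : A) : act hC x (c • a) = c • act hC x a :=
  hC.ι_inj (by simp [iota_act, adl_smul_right])
theorem act_one_left (a : A) : act hC 1 a = a :=
  hC.ι_inj (by simp [iota_act, adl_one_left])
theorem act_mul_left (x y : H) (a : A) : act hC (x * y) a = act hC x (act hC y a) :=
  hC.ι_inj (by simp [iota_act, adl_mul_left])
theorem act_mul_right (h : H) (a b : A) :
    act hC h (a * b) = sw k (fun x y => act hC x a * act hC y b) h :=
  hC.ι_inj (by simp [iota_act, adl_mul_right, map_sw, hC.ι_mul])
theorem act_mul_eq (h : H) (a b : A) : act hC h a * b =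
    sw k (fun x y => act hC x (a * act hC (HopfAlgebra.antipode k y) b)) h :=
  hC.ι_inj (by simp only [map_sw, hC.ι_mul, iota_act]; exact adl_mul_eq _ _ _)
theorem mul_eq_sw_act (h : H) (a : A) : h * ι a = sw k (fun x y => ι (act hC x a) * y) h := by
  simp only [iota_act]; exact mul_eq_sw_adl _ _

def actL : H →ₗ[k] A →ₗ[k] A :=
  LinearMap.mk₂ k (act hC) (act_add_left hC) (act_smul_left hC) (act_add_right hC)
    (fun c x a => act_smul_right hC c x a)

@[simp] theorem actL_apply (h : H) (a : A) : actL hC h a = act hC h a := rfl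

theorem act_zero_right (h : H) : act hC h 0 = 0 := map_zero (actL hC h)
theorem act_zero_left (a : A) : act hC 0 a = 0 := by
  rw [← actL_apply, map_zero, LinearMap.zero_apply]

theorem counit_act (h : H) (a : A) :
    counit (R := k) (act hC h a) = counit (R := k) h * counit (R := k) a := by
  rw [← hC.ι_counit, iota_act, adl_eq_sw, map_sw]
  simp only [Bialgebra.counit_mul, HopfAlgebra.counit_antipode, hC.ι_counit]
  have := sw_counit_left (k := k) (G := fun y : H => counit (R := k) y * counit (R := k) a)
    (by constructor <;> intros <;> simp [add_mul, mul_assoc]) h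
  rw [← this]
  apply sw_congr; intro x y; simp only [smul_eq_mul]; ring

theorem act_iota (b a : A) : act hC (ι b) a = counit (R := k) b • a := by
  apply hC.ι_inj
  rw [iota_act, adl_eq_sw, sw_iota hC]
  · have : ∀ x y : A, ι x * ι a * HopfAlgebra.antipode k (ι y) =
       ι (a * (x * HopfAlgebra.antipode k y)) := by
      intro x y
      rw [← hC.ι_antipode, ← hC.ι_mul, ← hC.ι_mul]; congr 1; ring
    simp only [this]
    rw [sw_S_right (G := fun w => ι (a * w))]
    · simp
    · constructor <;> intros <;> simp [mul_add]
  · constructor <;> intros <;> constructor <;> intros <;> simp [add_mul, mul_add]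

theorem stable_iff (I : Ideal A) : IsHStable k A H ι I ↔ ∀ h, ∀ a ∈ I, act hC h a ∈ I := by
  constructor
  · intro hI h a ha
    obtain ⟨b, hb, e⟩ := hI h a ha
    have : b = act hC h a := hC.ι_inj (by rw [e, iota_act])
    exact this ▸ hb
  · intro hI h a ha
    exact ⟨_, hI h a ha, iota_act hC h a⟩

theorem left_le_right {J : Ideal A} (hJ : ∀ h, ∀ a ∈ J, act hC h a ∈ J) :
    leftMul k A H ι J ≤ rightMul k A H ι J := by
  rw [leftMul, Submodule.span_le]
  rintro _ ⟨h, a, ha, rfl⟩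
  rw [mul_eq_sw_act hC]
  exact sw_mem _ _ _ fun x y => Submodule.subset_span ⟨y, _, hJ x a ha, rfl⟩

theorem rightMul_mul {J : Ideal A} {x : H} (hx : x ∈ rightMul k A H ι J) (h : H) :
    x * h ∈ rightMul k A H ι J := by
  have : rightMul k A H ι J ≤ (rightMul k A H ι J).comap (LinearMap.mulRight k h) := by
    conv_lhs => rw [rightMul]
    rw [Submodule.span_le]
    rintro _ ⟨h', a, ha, rfl⟩
    exact Submodule.subset_span ⟨h' * h, a, ha, by simp [mul_assoc]⟩
  exact this hx

theorem mul_leftMul {J : Ideal A} {x : H} (hx : x ∈ leftMul k A H ι J) (h : H) :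
    h * x ∈ leftMul k A H ι J := by
  have : leftMul k A H ι J ≤ (leftMul k A H ι J).comap (LinearMap.mulLeft k h) := by
    conv_lhs => rw [leftMul]
    rw [Submodule.span_le]
    rintro _ ⟨h', a, ha, rfl⟩
    exact Submodule.subset_span ⟨h * h', a, ha, by simp [mul_assoc]⟩
  exact this hx

theorem mul_rightMul (hC : CommByFinite k A H ι) {J : Ideal A} (hJ : ∀ h, ∀ a ∈ J, act hC h a ∈ J) {x : H}
    (hx : x ∈ rightMul k A H ι J) (h : H) : h * x ∈ rightMul k A H ι J := by
  have : rightMul k A H ι J ≤ (rightMul k A H ι J).comap (LinearMap.mulLeft k h) := by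
    conv_lhs => rw [rightMul]
    rw [Submodule.span_le]
    rintro _ ⟨h', a, ha, rfl⟩
    simp only [SetLike.mem_coe, Submodule.mem_comap, LinearMap.mulLeft_apply, ← mul_assoc]
    apply rightMul_mul
    exact left_le_right hC hJ (Submodule.subset_span ⟨h, a, ha, rfl⟩)
  exact this hx

theorem aug_eq : augHIdeal k A H ι = rightMul k A H ι (augIdeal k A) := by
  unfold augHIdeal rightMul augIdeal
  congr 1
  ext x
  constructor
  · rintro ⟨a, h, ha, rfl⟩; exact ⟨h, a, ha, rfl⟩
  · rintro ⟨h, a, ha, rfl⟩; exact ⟨a, h, ha, rfl⟩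

theorem aug_stable (h : H) (a : A) (ha : a ∈ augIdeal k A) : act hC h a ∈ augIdeal k A := by
  have : counit (R := k) a = 0 := ha
  change counit (R := k) (act hC h a) = 0
  rw [counit_act, this, mul_zero]

def KI : Ideal H where
  carrier := augHIdeal k A H ι
  add_mem' := fun h1 h2 => add_mem h1 h2
  zero_mem' := zero_mem _
  smul_mem' := by
    intro c x hx
    rw [aug_eq] at *
    exact mul_rightMul hC (aug_stable hC) hx c

theorem mem_KI {x : H} : x ∈ KI hC ↔ x ∈ augHIdeal k A H ι := Iff.rfl

instance KI_two : (KI hC).IsTwoSided := ⟨fun {a} b ha => by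
  rw [mem_KI, aug_eq] at *; exact rightMul_mul ha b⟩

theorem aug_antipode (a : A) (ha : a ∈ augIdeal k A) : HopfAlgebra.antipode k a ∈ augIdeal k A := by
  change counit (R := k) _ = 0
  rw [HopfAlgebra.counit_antipode]; exact ha

theorem sub_counit (a : A) : a - algebraMap k A (counit (R := k) a) ∈ augIdeal k A := by
  change counit (R := k) _ = 0
  simp

theorem mk_iota (a : A) (h : H) : Ideal.Quotient.mk (KI hC) (ι a * h) =
    counit (R := k) a • Ideal.Quotient.mk (KI hC) h := by
  have e : counit (R := k) a • Ideal.Quotient.mk (KI hC) h =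
     Ideal.Quotient.mk (KI hC) (counit (R := k) a • h) := rfl
  rw [e, Ideal.Quotient.mk_eq_mk_iff_sub_mem, mem_KI, aug_eq]
  refine Submodule.subset_span ⟨h, _, sub_counit a, ?_⟩
  rw [map_sub, Algebra.algebraMap_eq_smul_one, map_smul, hC.ι_one, sub_mul]; simp

theorem counit_KI (hC : CommByFinite k A H ι) {x : H} (hx : x ∈ augHIdeal k A H ι) : counit (R := k) x = 0 := by
  have : augHIdeal k A H ι ≤ LinearMap.ker (counit (R := k)) := by
    rw [augHIdeal, Submodule.span_le]
    rintro _ ⟨a, h, ha, rfl⟩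
    simp [hC.ι_counit, ha]
  exact this hx

instance KI_coideal : ((KI hC).restrictScalars k).IsCoideal where
  counit_eq_zero := fun x hx => counit_KI hC hx
  map_mkQ_comul_eq_zero := fun x hx => by
    let P := (KI hC).restrictScalars k
    have : augHIdeal k A H ι ≤ LinearMap.ker (TensorProduct.map P.mkQ P.mkQ ∘ₗ comul) := by
      rw [augHIdeal, Submodule.span_le]
      rintro _ ⟨a, h, ha, rfl⟩
      simp only [SetLike.mem_coe, LinearMap.mem_ker, LinearMap.comp_apply]
      have hb : Bil k (fun x y : H => P.mkQ x ⊗ₜ[k] P.mkQ y) := by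
        constructor <;> intros <;> constructor <;> intros <;>
          simp [add_tmul, tmul_add, smul_tmul']
      have e : ∀ x : H, TensorProduct.map P.mkQ P.mkQ (comul x) = sw k (fun x y : H => P.mkQ x ⊗ₜ[k] P.mkQ y) x := by
        intro x
        rw [← (ℛ k x).eq]; simp [sw]
      rw [e, sw_mul hb, sw_iota hC]
      · have : ∀ (a : A) (h : H), P.mkQ (ι a * h) = counit (R := k) a • P.mkQ h := mk_iota hC
        simp only [this]
        simp only [TensorProduct.smul_tmul_smul, mul_smul, ← sw_smul]
        rw [sw_counit_left (G := fun y : A => counit (R := k) y • sw k (fun x y : H => P.mkQ x ⊗ₜ[k] P.mkQ y) h)]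
        · simp [ha]
        · constructor <;> intros <;> simp [add_smul, mul_smul]
      · constructor <;> intros <;> constructor <;> intros <;> simp [add_mul, mul_add, add_tmul, tmul_add, smul_tmul', sw_add, sw_smul]
    exact this hx

instance KI_hopf : (KI hC).IsHopfIdeal k where
  toIsCoideal := KI_coideal hC
  antipode_mem := fun x hx => by
    have : augHIdeal k A H ι ≤ ((KI hC).restrictScalars k).comap (HopfAlgebra.antipode k) := by
      rw [augHIdeal, Submodule.span_le]
      rintro _ ⟨a, h, ha, rfl⟩
      change HopfAlgebra.antipode k _ ∈ augHIdeal k A H ι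
      rw [HopfAlgebra.antipode_mul_antidistrib, ← hC.ι_antipode, aug_eq]
      exact left_le_right hC (aug_stable hC) (Submodule.subset_span ⟨_, _, aug_antipode a ha, rfl⟩)
    exact this hx

theorem act_KI {x : H} (hx : x ∈ augHIdeal k A H ι) (a : A) : act hC x a = 0 := by
  have : augHIdeal k A H ι ≤ LinearMap.ker ((actL hC).flip a) := by
    rw [augHIdeal, Submodule.span_le]
    rintro _ ⟨b, h, hb, rfl⟩
    simp [act_mul_left, act_iota, hb]
  exact this hx

instance KI_nontriv : Nontrivial (H ⧸ KI hC) := by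
  apply Ideal.Quotient.nontrivial_iff.2
  intro h
  have : (1 : H) ∈ KI hC := h ▸ Submodule.mem_top
  have := counit_KI hC this
  simp at this

theorem iota_sub (hC : CommByFinite k A H ι) (g : A →ₐ[k] k) (a : A) (y : H) :
    ι a * y - g a • y = ι (a - algebraMap k A (g a)) * y := by
  rw [map_sub, Algebra.algebraMap_eq_smul_one, map_smul, hC.ι_one, sub_mul]; simp

theorem iota_sub' (hC : CommByFinite k A H ι) (g : A →ₐ[k] k) (a : A) (y : H) :
    y * ι a - g a • y = y * ι (a - algebraMap k A (g a)) := by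
  rw [map_sub, Algebra.algebraMap_eq_smul_one, map_smul, hC.ι_one, mul_sub]; simp

theorem sub_mem_ker (g : A →ₐ[k] k) (a : A) : a - algebraMap k A (g a) ∈ RingHom.ker g := by
  simp [RingHom.mem_ker]

theorem fin_aux (hC : CommByFinite k A H ι) (P : Submodule k H) (g : A →ₐ[k] k)
    (hP : rightMul k A H ι (RingHom.ker g) ≤ P) :
    FiniteDimensional k (H ⧸ P) := by
  obtain ⟨s, hs⟩ := hC.finiteOver
  refine ⟨Submodule.fg_def.2 ⟨P.mkQ '' s, s.finite_toSet.image _, ?_⟩⟩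
  rw [eq_top_iff, ← P.range_mkQ, LinearMap.range_eq_map, ← hs, Submodule.map_le_iff_le_comap,
    Submodule.span_le]
  rintro _ ⟨a, y, hy, rfl⟩
  have : P.mkQ (ι a * y) = g a • P.mkQ y := by
    rw [← map_smul, ← sub_eq_zero, ← map_sub, iota_sub hC]
    simp only [Submodule.mkQ_apply, Submodule.Quotient.mk_eq_zero]
    exact hP (Submodule.subset_span ⟨y, _, sub_mem_ker g a, rfl⟩)
  simp only [SetLike.mem_coe, Submodule.mem_comap, this]
  exact Submodule.smul_mem _ _ (Submodule.subset_span ⟨y, hy, rfl⟩)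

instance fin_K : FiniteDimensional k (H ⧸ KI hC) :=
  fin_aux hC ((KI hC).restrictScalars k) (Bialgebra.counitAlgHom k A) (by
    have := (aug_eq (k := k) (A := A) (H := H) (ι := ι)).ge
    exact this)

theorem exists_T (hC : CommByFinite k A H ι) : ∃ T : H →ₗ[k] H, ∀ h : H,
    sw k (fun x y => y * T x) h - counit (R := k) h • (1 : H) ∈ augHIdeal k A H ι := by
  have inj := antipode_injective (k := k) (B := H ⧸ KI hC)
  let e := LinearEquiv.ofInjectiveEndo (HopfAlgebra.antipode k (A := H ⧸ KI hC)) inj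
  let π : H →ₗ[k] (H ⧸ KI hC) := (Ideal.Quotient.mkₐ k (KI hC)).toLinearMap
  have hπ : Function.Surjective π := Ideal.Quotient.mk_surjective
  obtain ⟨σ, hσ⟩ := π.exists_rightInverse_of_surjective (LinearMap.range_eq_top.2 hπ)
  have hσ' : ∀ x, π (σ x) = x := fun x => by simpa using LinearMap.congr_fun hσ x
  have hmul : ∀ x y, π (x * y) = π x * π y := fun x y => map_mul (Ideal.Quotient.mkₐ k (KI hC)) x y
  have hS : ∀ x, HopfAlgebra.antipode k (π x) = π (HopfAlgebra.antipode k x) := fun x => rfl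
  let T := σ ∘ₗ e.symm.toLinearMap ∘ₗ π
  have hT : ∀ x, HopfAlgebra.antipode k (π (T x)) = π x := by
    intro x
    simp only [T, LinearMap.comp_apply, hσ']
    exact e.apply_symm_apply _
  refine ⟨T, fun h => ?_⟩
  rw [← mem_KI hC, ← Ideal.Quotient.mk_eq_mk_iff_sub_mem]
  change π _ = π _
  apply inj
  rw [map_sw, map_sw]
  simp only [hmul, HopfAlgebra.antipode_mul_antidistrib, hT]
  simp only [hS, ← hmul]
  rw [← map_sw π (fun x y => x * HopfAlgebra.antipode k y)]
  have := sw_S_right (k := k) (G := fun w : H => w) ⟨fun _ _ => rfl, fun _ _ => rfl⟩ h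
  rw [this, map_smul (HopfAlgebra.antipode k), HopfAlgebra.antipode_one]

theorem right_le_left (hC : CommByFinite k A H ι) {J : Ideal A} (hJ : ∀ h, ∀ a ∈ J, act hC h a ∈ J) :
    rightMul k A H ι J ≤ leftMul k A H ι J := by
  obtain ⟨T, hT⟩ := exists_T hC
  rw [rightMul, Submodule.span_le]
  rintro _ ⟨h, a, ha, rfl⟩
  have : ι a * h = sw k (fun x y => y * ι (act hC (T x) a)) h := by
    simp only [mul_eq_sw_act hC, ← act_mul_left]
    rw [← sw_coassoc (F := fun x u v => ι (act hC (u * T x) a) * v)]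
    · simp only [← sw_mul_right]
      have e : ∀ y, sw k (fun x u => ι (act hC (u * T x) a)) y = counit (R := k) y • ι a := by
        intro y
        have := act_KI hC (hT y) a
        have h2 : (ι ∘ₗ (actL hC).flip a) (sw k (fun x y => y * T x) y - counit (R := k) y • 1) = 0 := by
          rw [LinearMap.comp_apply, LinearMap.flip_apply, actL_apply, this, map_zero]
        rw [map_sub, map_sw, sub_eq_zero] at h2
        simpa [act_one_left, act_smul_left] using h2
      simp only [e, smul_mul_assoc]
      rw [sw_counit_left (G := fun y => ι a * y)]
      constructor <;> intros <;> simp [mul_add]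
    · constructor <;> intros <;> constructor <;> intros <;>
        simp [add_mul, mul_add, act_add_left, act_smul_left]
  rw [this]
  exact sw_mem _ _ _ fun x y => Submodule.subset_span ⟨y, _, hJ _ a ha, rfl⟩

theorem left_eq_right (hC : CommByFinite k A H ι) {J : Ideal A} (hJ : ∀ h, ∀ a ∈ J, act hC h a ∈ J) :
    leftMul k A H ι J = rightMul k A H ι J :=
  le_antisymm (left_le_right hC hJ) (right_le_left hC hJ)

end Act
end
end Paper


open TensorProduct LinearMap Coalgebra

namespace Paper

noncomputable section
set_option linter.all false
set_option linter.unusedSectionVars false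
section Points
variable {k : Type} [Field k]
variable {A : Type} [CommRing A] [Algebra k A]

theorem ker_inj {g h : A →ₐ[k] k} (e : RingHom.ker g ≤ RingHom.ker h) : g = h := by
  ext a
  have : a - algebraMap k A (g a) ∈ RingHom.ker g := by simp [RingHom.mem_ker]
  have := e this
  rw [RingHom.mem_ker] at this
  simp [sub_eq_zero] at this
  exact this.symm

instance ker_max (g : A →ₐ[k] k) : (RingHom.ker g).IsMaximal :=
  RingHom.ker_isMaximal_of_surjective g (fun c => ⟨algebraMap k A c, by simp⟩)

theorem nullst [IsAlgClosed k] [Algebra.FiniteType k A] (m : Ideal A) [hm : m.IsMaximal] :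
    ∃ g : A →ₐ[k] k, RingHom.ker g = m := by
  letI := Ideal.Quotient.field m
  have : Module.Finite k (A ⧸ m) := finite_of_finite_type_of_isJacobsonRing k (A ⧸ m)
  have hb := IsAlgClosed.algebraMap_bijective_of_isIntegral (k := k) (K := A ⧸ m)
  let e := AlgEquiv.ofBijective (Algebra.ofId k (A ⧸ m)) hb
  refine ⟨(e.symm : (A ⧸ m) →ₐ[k] k).comp (Ideal.Quotient.mkₐ k m), ?_⟩
  ext a
  simp [RingHom.mem_ker, Ideal.Quotient.eq_zero_iff_mem]

theorem exists_idem (F : Finset (A →ₐ[k] k)) : ∃ e : (A →ₐ[k] k) → A,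
    (∀ h ∈ F, h (e h) = 1) ∧ ∀ h, ∀ h' ∈ F, h ≠ h' → h' (e h) = 0 := by
  classical
  have sep : ∀ h h' : A →ₐ[k] k, ∃ a : A, h a = 1 ∧ (h ≠ h' → h' a = 0) := by
    intro h h'
    by_cases hh : h = h'
    · exact ⟨1, by simp, fun h => absurd hh h⟩
    · obtain ⟨a, ha⟩ : ∃ a, h a ≠ h' a := by
        by_contra hc; push Not at hc; exact hh (AlgHom.ext hc)
      have h0 : h a - h' a ≠ 0 := sub_ne_zero.2 ha
      refine ⟨(h a - h' a)⁻¹ • (a - algebraMap k A (h' a)), ?_, fun _ => ?_⟩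
      · simp [h0]
      · simp
  choose a ha1 ha2 using sep
  refine ⟨fun h => ∏ h' ∈ F, a h h', ?_, ?_⟩
  · intro h _
    simp [map_prod, ha1]
  · intro h h' hF hne
    rw [map_prod]
    exact Finset.prod_eq_zero hF (ha2 _ _ hne)

theorem semis [IsAlgClosed k] [Algebra.FiniteType k A] (J : Ideal A) [IsSemisimpleRing (A ⧸ J)] :
    {g : A →ₐ[k] k | J ≤ RingHom.ker g}.Finite ∧
      ∀ a, (∀ g : A →ₐ[k] k, J ≤ RingHom.ker g → g a = 0) → a ∈ J := by
  constructor
  · have := (IsArtinianRing.setOfPred_isMaximal_finite (A ⧸ J)).image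
      (Ideal.comap (Ideal.Quotient.mk J))
    apply Set.Finite.of_finite_image (f := fun g : A →ₐ[k] k => RingHom.ker g)
    · apply this.subset
      rintro _ ⟨g, hg, rfl⟩
      refine ⟨(RingHom.ker g).map (Ideal.Quotient.mk J), ?_, Ideal.comap_map_mk hg⟩
      rcases Ideal.map_eq_top_or_isMaximal_of_surjective (Ideal.Quotient.mk J)
        Ideal.Quotient.mk_surjective (ker_max g) with h | h
      · exfalso
        have h2 := Ideal.comap_map_mk hg
        rw [h, Ideal.comap_top] at h2
        exact (ker_max g).ne_top h2.symm
      · exact h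
    · intro g hg g' hg' e
      exact ker_inj (le_of_eq e)
  · intro a ha
    rw [← Ideal.Quotient.eq_zero_iff_mem]
    have hj := IsSemisimpleRing.jacobson_eq_bot (A ⧸ J)
    rw [← Ideal.mem_bot, ← hj, Ring.jacobson_eq_sInf_isMaximal, Ideal.mem_sInf]
    intro n hn
    have hn' : n.IsMaximal := hn
    have : (n.comap (Ideal.Quotient.mk J)).IsMaximal :=
      Ideal.comap_isMaximal_of_surjective _ Ideal.Quotient.mk_surjective
    obtain ⟨g, hg⟩ := nullst (k := k) (n.comap (Ideal.Quotient.mk J))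
    have h1 : J ≤ RingHom.ker g := by
      rw [hg]
      intro x hx
      rw [Ideal.mem_comap, Ideal.Quotient.eq_zero_iff_mem.2 hx]
      exact zero_mem _
    have h2 : a ∈ RingHom.ker g := ha g h1
    rw [hg] at h2
    exact h2

end Points

section CRT
variable {k : Type} [Field k] {M : Type} [AddCommGroup M] [Module k M] {X : Type}

theorem crt_inf (O : Finset X) (E : X → M →ₗ[k] M) (Q : Submodule k M) (Qh : X → Submodule k M)
    (h1 : ∀ h ∈ O, Q ≤ Qh h) (h2 : ∀ h ∈ O, ∀ x ∈ Qh h, E h x ∈ Q)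
    (h3 : ∀ x, x - ∑ h ∈ O, E h x ∈ Q) : Q = ⨅ h ∈ O, Qh h := by
  apply le_antisymm
  · exact le_iInf₂ h1
  · intro x hx
    simp only [Submodule.mem_iInf] at hx
    have : x = (x - ∑ h ∈ O, E h x) + ∑ h ∈ O, E h x := by abel
    rw [this]
    exact add_mem (h3 x) (sum_mem fun h hh => h2 h hh x (hx h hh))

theorem crt_finrank (O : Finset X) (E : X → M →ₗ[k] M) (Q : Submodule k M) (Qh : X → Submodule k M)
    (h1 : ∀ h ∈ O, Q ≤ Qh h) (h2 : ∀ h ∈ O, ∀ x ∈ Qh h, E h x ∈ Q)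
    (h3 : ∀ x, x - ∑ h ∈ O, E h x ∈ Q) (h4 : ∀ h ∈ O, ∀ x, E h x - x ∈ Qh h)
    (h5 : ∀ h ∈ O, ∀ h' ∈ O, h ≠ h' → ∀ x, E h x ∈ Qh h') 
    [fd : ∀ h, FiniteDimensional k (M ⧸ Qh h)] :
    FiniteDimensional k (M ⧸ Q) ∧
    Module.finrank k (M ⧸ Q) = ∑ h ∈ O, Module.finrank k (M ⧸ Qh h) := by
  classical
  let f : M →ₗ[k] (∀ h : O, M ⧸ Qh h.1) := LinearMap.pi fun h => (Qh h.1).mkQ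
  have hk : LinearMap.ker f = Q := by
    rw [crt_inf O E Q Qh h1 h2 h3]
    ext x
    simp [f, LinearMap.mem_ker, funext_iff, Submodule.mem_iInf]
  have hs : Function.Surjective f := by
    intro y
    have := fun h => Submodule.mkQ_surjective _ (y h)
    choose z hz using this
    refine ⟨∑ h : O, E h.1 (z h), ?_⟩
    ext h
    rw [← hz h]
    simp only [f, LinearMap.pi_apply, map_sum]
    rw [Finset.sum_eq_single h]
    · rw [← sub_eq_zero, ← map_sub, Submodule.mkQ_apply, Submodule.Quotient.mk_eq_zero]
      exact h4 h.1 h.2 (z h)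
    · intro b _ hb
      simpa using h5 b.1 b.2 h.1 h.2 (fun e => hb (Subtype.ext e)) (z b)
    · simp
  let e := (Submodule.quotEquivOfEq _ _ hk.symm).trans (f.quotKerEquivOfSurjective hs)
  refine ⟨Module.Finite.equiv e.symm, ?_⟩
  rw [e.finrank_eq, Module.finrank_pi_fintype, ← Finset.sum_coe_sort O]

end CRT

section Orb
variable {k : Type} [Field k]
variable {A : Type} [CommRing A] [HopfAlgebra k A]
variable {H : Type} [Ring H] [HopfAlgebra k H]
variable {ι : A →ₗ[k] H} (hC : CommByFinite k A H ι)
variable {core : Ideal A → Ideal A}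

theorem fintype_A (hC : CommByFinite k A H ι) : Algebra.FiniteType k A := by
  obtain ⟨s, hs⟩ := hC.affine
  exact ⟨⟨s, hs⟩⟩

theorem core_stable (hC : CommByFinite k A H ι)
    (hcore : ∀ m : Ideal A, m.IsMaximal → IsCore k A H ι m (core m)) (g : A →ₐ[k] k) :
    ∀ h, ∀ a ∈ core (RingHom.ker g), act hC h a ∈ core (RingHom.ker g) :=
  (stable_iff hC _).1 (hcore _ (ker_max g)).1

theorem core_le (hcore : ∀ m : Ideal A, m.IsMaximal → IsCore k A H ι m (core m)) (g : A →ₐ[k] k) :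
    core (RingHom.ker g) ≤ RingHom.ker g :=
  (hcore _ (ker_max g)).2.1

theorem le_core (hC : CommByFinite k A H ι)
    (hcore : ∀ m : Ideal A, m.IsMaximal → IsCore k A H ι m (core m)) (g : A →ₐ[k] k)
    {I : Ideal A} (hI : ∀ h, ∀ a ∈ I, act hC h a ∈ I) (h : I ≤ RingHom.ker g) :
    I ≤ core (RingHom.ker g) :=
  (hcore _ (ker_max g)).2.2 I ((stable_iff hC _).2 hI) h

theorem core_eq [IsAlgClosed k] (hC : CommByFinite k A H ι)
    (hcore : ∀ m : Ideal A, m.IsMaximal → IsCore k A H ι m (core m))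
    (horb : OrbSemi A core) (g h : A →ₐ[k] k) (hh : core (RingHom.ker g) ≤ RingHom.ker h) :
    core (RingHom.ker h) = core (RingHom.ker g) := by
  classical
  have := fintype_A hC
  set J := core (RingHom.ker g) with hJ
  set I := core (RingHom.ker h) with hI
  have : IsSemisimpleRing (A ⧸ J) := horb _ (ker_max g)
  have : IsSemisimpleRing (A ⧸ I) := horb _ (ker_max h)
  have sJ := semis (k := k) J
  have sI := semis (k := k) I
  have stJ : ∀ h, ∀ a ∈ J, act hC h a ∈ J := core_stable hC hcore g
  have stI : ∀ h, ∀ a ∈ I, act hC h a ∈ I := core_stable hC hcore h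
  have hJI : J ≤ I := le_core hC hcore h stJ hh
  refine le_antisymm ?_ hJI
  let C : Ideal A :=
    { carrier := {a | ∀ b ∈ I, a * b ∈ J}
      add_mem' := fun {a b} ha hb c hc => by rw [add_mul]; exact add_mem (ha c hc) (hb c hc)
      zero_mem' := fun c hc => by rw [zero_mul]; exact zero_mem _
      smul_mem' := fun c a ha b hb => by
        rw [smul_eq_mul, mul_assoc]; exact J.mul_mem_left _ (ha b hb) }
  have stC : ∀ h, ∀ a ∈ C, act hC h a ∈ C := by
    intro h a ha b hb
    rw [act_mul_eq]
    exact sw_mem (J.restrictScalars k) _ _ fun x y => stJ _ _ (ha _ (stI _ _ hb))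
  have hor : I ≤ RingHom.ker g ∨ C ≤ RingHom.ker g := by
    rw [← (ker_max g).isPrime.mul_le]
    rw [Ideal.mul_le]
    intro r hr s hs
    rw [mul_comm]
    exact core_le hcore g (hs r hr)
  rcases hor with h1 | h1
  · exact le_core hC hcore g stI h1
  · exfalso
    have hCJ : C ≤ J := le_core hC hcore g stC h1
    obtain ⟨e, he1, he2⟩ := exists_idem sJ.1.toFinset
    have hm : ∀ p, p ∈ sJ.1.toFinset ↔ J ≤ RingHom.ker p := by simp
    let e' := ∑ p ∈ sJ.1.toFinset with ¬ I ≤ RingHom.ker p, e p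
    have e1 : e' ∈ I := by
      apply sI.2
      intro p hp
      rw [map_sum]
      refine Finset.sum_eq_zero fun q hq => ?_
      rw [Finset.mem_filter] at hq
      apply he2
      · rw [hm]; exact hJI.trans hp
      · rintro rfl; exact hq.2 hp
    have e2 : 1 - e' ∈ C := by
      intro b hb
      apply sJ.2
      intro p hp
      rw [map_mul]
      by_cases hp' : I ≤ RingHom.ker p
      · have : p b = 0 := hp' hb
        rw [this, mul_zero]
      · have : p e' = 1 := by
          rw [map_sum, Finset.sum_eq_single p]
          · exact he1 p ((hm p).2 hp)
          · intro q hq hqp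
            exact he2 _ _ ((hm p).2 hp) hqp
          · intro hn
            exact absurd (Finset.mem_filter.2 ⟨(hm p).2 hp, hp'⟩) hn
        rw [map_sub, map_one, this, sub_self, zero_mul]
    have e3 : h e' = 0 := core_le hcore h e1
    have e4 : h (1 - e') = 0 := hh (hCJ e2)
    rw [map_sub, e3] at e4
    simp at e4

/-- the orbit -/
theorem exists_orb [IsAlgClosed k] (hC : CommByFinite k A H ι)
    (hcore : ∀ m : Ideal A, m.IsMaximal → IsCore k A H ι m (core m))
    (horb : OrbSemi A core) (g : A →ₐ[k] k) : ∃ O : Finset (A →ₐ[k] k),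
      (∀ h, h ∈ O ↔ core (RingHom.ker h) = core (RingHom.ker g)) ∧
      (∀ h, h ∈ O ↔ core (RingHom.ker g) ≤ RingHom.ker h) ∧
      ∀ a, a ∈ core (RingHom.ker g) ↔ ∀ h ∈ O, h a = 0 := by
  have := fintype_A hC
  have : IsSemisimpleRing (A ⧸ core (RingHom.ker g)) := horb _ (ker_max g)
  have sJ := semis (k := k) (core (RingHom.ker g))
  have h2 : ∀ h, h ∈ sJ.1.toFinset ↔ core (RingHom.ker g) ≤ RingHom.ker h := by simp
  refine ⟨sJ.1.toFinset, ?_, h2, ?_⟩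
  · intro h
    rw [h2]
    exact ⟨core_eq hC hcore horb g h, fun e => e ▸ core_le hcore h⟩
  · intro a
    constructor
    · intro ha h hh
      exact (h2 h).1 hh ha
    · intro ha
      exact sJ.2 a fun p hp => ha p ((h2 p).2 hp)

/-- CRT for right multiplication. -/
theorem crt_left (hC : CommByFinite k A H ι) (O : Finset (A →ₐ[k] k)) (J : Ideal A)
    (hJ : ∀ a, a ∈ J ↔ ∀ h ∈ O, h a = 0) (P : Submodule k H) (hP : ∀ x ∈ P, ∀ a, x * ι a ∈ P) :
    P ⊔ leftMul k A H ι J = ⨅ h ∈ O, (P ⊔ leftMul k A H ι (RingHom.ker h)) ∧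
    ((∀ h : A →ₐ[k] k, FiniteDimensional k (H ⧸ (P ⊔ leftMul k A H ι (RingHom.ker h)))) →
      FiniteDimensional k (H ⧸ (P ⊔ leftMul k A H ι J)) ∧
      Module.finrank k (H ⧸ (P ⊔ leftMul k A H ι J)) =
        ∑ h ∈ O, Module.finrank k (H ⧸ (P ⊔ leftMul k A H ι (RingHom.ker h)))) := by
  classical
  obtain ⟨e, he1, he2⟩ := exists_idem O
  let E : (A →ₐ[k] k) → H →ₗ[k] H := fun h => LinearMap.mulRight k (ι (e h))
  have mem : ∀ (I : Ideal A) (x : H) (a : A), a ∈ I → x * ι a ∈ P ⊔ leftMul k A H ι I :=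
    fun I x a ha => Submodule.mem_sup_right (Submodule.subset_span ⟨x, a, ha, rfl⟩)
  have h1 : ∀ h ∈ O, P ⊔ leftMul k A H ι J ≤ P ⊔ leftMul k A H ι (RingHom.ker h) := by
    intro h hh
    refine sup_le_sup_left (Submodule.span_mono ?_) _
    rintro _ ⟨x, a, ha, rfl⟩
    exact ⟨x, a, (hJ a).1 ha h hh, rfl⟩
  have h2 : ∀ h ∈ O, ∀ x ∈ P ⊔ leftMul k A H ι (RingHom.ker h), E h x ∈ P ⊔ leftMul k A H ι J := by
    intro h hh
    have : P ⊔ leftMul k A H ι (RingHom.ker h) ≤ (P ⊔ leftMul k A H ι J).comap (E h) := by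
      refine sup_le ?_ ?_
      · intro x hx
        exact Submodule.mem_sup_left (hP x hx _)
      · rw [leftMul, Submodule.span_le]
        rintro _ ⟨x, a, ha, rfl⟩
        simp only [SetLike.mem_coe, Submodule.mem_comap, E, LinearMap.mulRight_apply, mul_assoc,
          ← hC.ι_mul]
        apply mem
        rw [hJ]
        intro h' hh'
        rw [map_mul]
        by_cases hb : h = h'
        · subst hb
          have : h a = 0 := ha
          rw [this, zero_mul]
        · rw [he2 h h' hh' hb, mul_zero]
    exact this
  have h3 : ∀ x, x - ∑ h ∈ O, E h x ∈ P ⊔ leftMul k A H ι J := by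
    intro x
    have : x - ∑ h ∈ O, E h x = x * ι (1 - ∑ h ∈ O, e h) := by
      simp [E, mul_sub, hC.ι_one, Finset.mul_sum]
    rw [this]
    apply mem
    rw [hJ]
    intro h hh
    rw [map_sub, map_sum, Finset.sum_eq_single h, he1 h hh, map_one, sub_self]
    · intro b _ hb
      exact he2 _ _ hh hb
    · intro hn; exact absurd hh hn
  refine ⟨crt_inf O E _ _ h1 h2 h3, fun fd => crt_finrank O E _ _ h1 h2 h3 ?_ ?_⟩
  · intro h hh x
    have : E h x - x = x * ι (e h - 1) := by simp [E, mul_sub, hC.ι_one]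
    rw [this]
    apply mem
    simp [RingHom.mem_ker, he1 h hh]
  · intro h hh h' hh' hn x
    exact mem _ _ _ (he2 h h' hh' hn)

/-- CRT for left multiplication. -/
theorem crt_right (hC : CommByFinite k A H ι) (O : Finset (A →ₐ[k] k)) (J : Ideal A)
    (hJ : ∀ a, a ∈ J ↔ ∀ h ∈ O, h a = 0) (P : Submodule k H) (hP : ∀ x ∈ P, ∀ a, ι a * x ∈ P) :
    P ⊔ rightMul k A H ι J = ⨅ h ∈ O, (P ⊔ rightMul k A H ι (RingHom.ker h)) ∧
    ((∀ h : A →ₐ[k] k, FiniteDimensional k (H ⧸ (P ⊔ rightMul k A H ι (RingHom.ker h)))) →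
      FiniteDimensional k (H ⧸ (P ⊔ rightMul k A H ι J)) ∧
      Module.finrank k (H ⧸ (P ⊔ rightMul k A H ι J)) =
        ∑ h ∈ O, Module.finrank k (H ⧸ (P ⊔ rightMul k A H ι (RingHom.ker h)))) := by
  classical
  obtain ⟨e, he1, he2⟩ := exists_idem O
  let E : (A →ₐ[k] k) → H →ₗ[k] H := fun h => LinearMap.mulLeft k (ι (e h))
  have mem : ∀ (I : Ideal A) (x : H) (a : A), a ∈ I → ι a * x ∈ P ⊔ rightMul k A H ι I :=
    fun I x a ha => Submodule.mem_sup_right (Submodule.subset_span ⟨x, a, ha, rfl⟩)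
  have h1 : ∀ h ∈ O, P ⊔ rightMul k A H ι J ≤ P ⊔ rightMul k A H ι (RingHom.ker h) := by
    intro h hh
    refine sup_le_sup_left (Submodule.span_mono ?_) _
    rintro _ ⟨x, a, ha, rfl⟩
    exact ⟨x, a, (hJ a).1 ha h hh, rfl⟩
  have h2 : ∀ h ∈ O, ∀ x ∈ P ⊔ rightMul k A H ι (RingHom.ker h), E h x ∈ P ⊔ rightMul k A H ι J := by
    intro h hh
    have : P ⊔ rightMul k A H ι (RingHom.ker h) ≤ (P ⊔ rightMul k A H ι J).comap (E h) := by
      refine sup_le ?_ ?_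
      · intro x hx
        exact Submodule.mem_sup_left (hP x hx _)
      · rw [rightMul, Submodule.span_le]
        rintro _ ⟨x, a, ha, rfl⟩
        simp only [SetLike.mem_coe, Submodule.mem_comap, E, LinearMap.mulLeft_apply, ← mul_assoc,
          ← hC.ι_mul]
        apply mem
        rw [hJ]
        intro h' hh'
        rw [map_mul]
        by_cases hb : h = h'
        · subst hb
          have : h a = 0 := ha
          rw [this, mul_zero]
        · rw [he2 h h' hh' hb, zero_mul]
    exact this
  have h3 : ∀ x, x - ∑ h ∈ O, E h x ∈ P ⊔ rightMul k A H ι J := by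
    intro x
    have : x - ∑ h ∈ O, E h x = ι (1 - ∑ h ∈ O, e h) * x := by
      simp [E, sub_mul, hC.ι_one, Finset.sum_mul]
    rw [this]
    apply mem
    rw [hJ]
    intro h hh
    rw [map_sub, map_sum, Finset.sum_eq_single h, he1 h hh, map_one, sub_self]
    · intro b _ hb
      exact he2 _ _ hh hb
    · intro hn; exact absurd hh hn
  refine ⟨crt_inf O E _ _ h1 h2 h3, fun fd => crt_finrank O E _ _ h1 h2 h3 ?_ ?_⟩
  · intro h hh x
    have : E h x - x = ι (e h - 1) * x := by simp [E, sub_mul, hC.ι_one]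
    rw [this]
    apply mem
    simp [RingHom.mem_ker, he1 h hh]
  · intro h hh h' hh' hn x
    exact mem _ _ _ (he2 h h' hh' hn)

end Orb
end
end Paper


open TensorProduct LinearMap Coalgebra

namespace Paper

noncomputable section
set_option linter.all false
set_option linter.unusedSectionVars false
section Parts
variable {k : Type} [Field k]

section Gen
variable {M : Type} [AddCommGroup M] [Module k M] {X : Type}

theorem dualAnn_finset (s : Finset X) (F : X → Submodule k M) :
    (⨅ g ∈ s, F g).dualAnnihilator = ⨆ g ∈ s, (F g).dualAnnihilator := by
  classical
  induction s using Finset.induction_on with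
  | empty => simp
  | insert a s ha ih =>
    rw [Finset.iInf_insert, Finset.iSup_insert, Subspace.dualAnnihilator_inf_eq, ih]

theorem fd_iInf (s : Finset X) (F : X → Submodule k M)
    (h : ∀ g ∈ s, FiniteDimensional k (M ⧸ F g)) : FiniteDimensional k (M ⧸ (⨅ g ∈ s, F g)) := by
  classical
  let f : M →ₗ[k] (∀ h : s, M ⧸ F h.1) := LinearMap.pi fun h => (F h.1).mkQ
  have hk : LinearMap.ker f = ⨅ g ∈ s, F g := by
    ext x
    simp [f, LinearMap.mem_ker, funext_iff, Submodule.mem_iInf]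
  have : ∀ h : s, FiniteDimensional k (M ⧸ F h.1) := fun x => h x.1 x.2
  rw [← hk]
  exact Module.Finite.equiv f.quotKerEquivRange.symm
end Gen

variable {A : Type} [CommRing A] [HopfAlgebra k A]
variable {H : Type} [Ring H] [HopfAlgebra k H]
variable {ι : A →ₗ[k] H}
variable {core : Ideal A → Ideal A}

theorem leftMul_mono {I J : Ideal A} (h : I ≤ J) : leftMul k A H ι I ≤ leftMul k A H ι J := by
  refine Submodule.span_mono ?_
  rintro _ ⟨x, a, ha, rfl⟩
  exact ⟨x, a, h ha, rfl⟩

theorem rightMul_mono {I J : Ideal A} (h : I ≤ J) : rightMul k A H ι I ≤ rightMul k A H ι J := by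
  refine Submodule.span_mono ?_
  rintro _ ⟨x, a, ha, rfl⟩
  exact ⟨x, a, h ha, rfl⟩

theorem charComp_iff (f : Module.Dual k H) :
    f ∈ charComp k A H ι core ↔ f ∈ ⨆ g, ghat k A H ι core g := by
  classical
  constructor
  · rintro ⟨s, -, hs⟩
    have : f ∈ (⨅ g ∈ s, leftMul k A H ι (core (RingHom.ker g))).dualAnnihilator := by
      rw [Submodule.mem_dualAnnihilator]; exact hs
    rw [dualAnn_finset] at this
    exact (iSup₂_le fun g _ => le_iSup (ghat k A H ι core) g) this
  · intro h
    rw [Submodule.mem_iSup_iff_exists_finset] at h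
    obtain ⟨s, hs⟩ := h
    refine ⟨insert (Bialgebra.counitAlgHom k A) s, Finset.insert_nonempty _ _, ?_⟩
    rw [← Submodule.mem_dualAnnihilator, dualAnn_finset]
    have hle : (⨆ g ∈ s, ghat k A H ι core g) ≤ ⨆ g ∈ insert (Bialgebra.counitAlgHom k A) s,
        (leftMul k A H ι (core (RingHom.ker g))).dualAnnihilator := iSup₂_le fun g hg => ?_
    · exact hle hs
    exact le_iSup₂_of_le (f := fun g (_ : g ∈ insert (Bialgebra.counitAlgHom k A) s) => 
      (leftMul k A H ι (core (RingHom.ker g))).dualAnnihilator) g (Finset.mem_insert_of_mem hg) le_rfl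

theorem mem_ghat {g : A →ₐ[k] k} {f : Module.Dual k H} :
    f ∈ ghat k A H ι core g ↔ ∀ (y : H), ∀ a ∈ core (RingHom.ker g), f (y * ι a) = 0 := by
  rw [ghat, Submodule.mem_dualAnnihilator]
  constructor
  · intro h y a ha
    exact h _ (Submodule.subset_span ⟨y, a, ha, rfl⟩)
  · intro h
    have : leftMul k A H ι (core (RingHom.ker g)) ≤ LinearMap.ker f := by
      rw [leftMul, Submodule.span_le]
      rintro _ ⟨y, a, ha, rfl⟩
      exact h y a ha
    exact this

/-- membership criterion -/
theorem mem_of_van (hC : CommByFinite k A H ι)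
    (hcore : ∀ m : Ideal A, m.IsMaximal → IsCore k A H ι m (core m))
    (s : Finset (A →ₐ[k] k)) (f : Module.Dual k H)
    (hf : ∀ (y : H) (a : A), (∀ c ∈ s, c a = 0) → f (y * ι a) = 0) :
    f ∈ ⨆ g ∈ s, ghat k A H ι core g := by
  have : f ∈ (⨅ g ∈ s, leftMul k A H ι (core (RingHom.ker g))).dualAnnihilator := by
    rw [Submodule.mem_dualAnnihilator]
    have h1 : (⨅ g ∈ s, leftMul k A H ι (core (RingHom.ker g))) ≤
      leftMul k A H ι (⨅ g ∈ s, RingHom.ker g) := by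
      have h2 := (crt_left hC s (⨅ g ∈ s, RingHom.ker g)
        (by intro a; simp [Submodule.mem_iInf, RingHom.mem_ker]) ⊥ (by
          intro x hx a; rw [Submodule.mem_bot] at *; simp [hx])).1
      simp only [bot_sup_eq] at h2
      rw [h2]
      exact iInf₂_mono fun g _ => leftMul_mono (core_le hcore g)
    have h3 : leftMul k A H ι (⨅ g ∈ s, RingHom.ker g) ≤ LinearMap.ker f := by
      rw [leftMul, Submodule.span_le]
      rintro _ ⟨y, a, ha, rfl⟩
      exact hf y a (by simpa [Submodule.mem_iInf, RingHom.mem_ker] using ha)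
    exact fun x hx => h3 (h1 hx)
  rw [dualAnn_finset] at this
  exact this

theorem core_inf [IsAlgClosed k] (hC : CommByFinite k A H ι)
    (hcore : ∀ m : Ideal A, m.IsMaximal → IsCore k A H ι m (core m))
    (g : A →ₐ[k] k) (O : Finset (A →ₐ[k] k)) 
    (hO : ∀ a, a ∈ core (RingHom.ker g) ↔ ∀ h ∈ O, h a = 0) :
    leftMul k A H ι (core (RingHom.ker g)) = ⨅ h ∈ O, leftMul k A H ι (RingHom.ker h) ∧
    leftMul k A H ι (core (RingHom.ker g)) = ⨅ h ∈ O, rightMul k A H ι (RingHom.ker h) ∧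
    FiniteDimensional k (H ⧸ leftMul k A H ι (core (RingHom.ker g))) ∧
    Module.finrank k (H ⧸ leftMul k A H ι (core (RingHom.ker g))) = 
      ∑ h ∈ O, Module.finrank k (H ⧸ rightMul k A H ι (RingHom.ker h)) := by
  have h1 := (crt_left hC O _ hO ⊥ (by
          intro x hx a; rw [Submodule.mem_bot] at *; simp [hx])).1
  have h2 := (crt_right hC O _ hO ⊥ (by
          intro x hx a; rw [Submodule.mem_bot] at *; simp [hx]))
  simp only [bot_sup_eq] at h1 h2
  have h3 := h2.2 (fun h => fin_aux hC _ h le_sup_right)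
  rw [← left_eq_right hC (core_stable hC hcore g)] at h2 h3
  have hq : ∀ X : Submodule k H, Module.finrank k (H ⧸ ⊥ ⊔ X) = Module.finrank k (H ⧸ X) :=
    fun X => by rw [bot_sup_eq]
  refine ⟨h1, h2.1, ?_, ?_⟩
  · have := h3.1
    rwa [bot_sup_eq] at this
  · have := h3.2
    simp only [hq] at this
    exact this

theorem conv_add_left (f f' g : Module.Dual k H) : conv k (f + f') g = conv k f g + conv k f' g := by
  ext x; simp [conv_eq_sw, add_mul, sw_add]
theorem conv_add_right (f g g' : Module.Dual k H) : conv k f (g + g') = conv k f g + conv k f g' := by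
  ext x; simp [conv_eq_sw, mul_add, sw_add]
theorem conv_zero_left (g : Module.Dual k H) : conv k 0 g = 0 := by
  ext x; simp [conv_eq_sw, sw]
theorem conv_zero_right (g : Module.Dual k H) : conv k g 0 = 0 := by
  ext x; simp [conv_eq_sw, sw]

theorem conv_mul_iota (hC : CommByFinite k A H ι) (f f' : Module.Dual k H) (y : H) (a : A) :
    conv k f f' (y * ι a) =
      sw k (fun y1 y2 => sw k (fun a1 a2 => f (y1 * ι a1) * f' (y2 * ι a2)) a) y := by
  rw [conv_eq_sw, sw_mul]
  · apply sw_congr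
    intro y1 y2
    rw [sw_iota hC]
    constructor <;> intros <;> constructor <;> intros <;> simp [add_mul, mul_add, mul_assoc, mul_left_comm]
  · constructor <;> intros <;> constructor <;> intros <;> simp [add_mul, mul_add, mul_assoc, mul_left_comm]

theorem exists_prod (g h : A →ₐ[k] k) : ∃ c : A →ₐ[k] k, ∀ a, c a = conv k g.toLinearMap h.toLinearMap a := by
  refine ⟨(Algebra.TensorProduct.lmul' k).comp ((Algebra.TensorProduct.map g h).comp
    (Bialgebra.comulAlgHom k A)), fun a => ?_⟩
  rw [conv_eq_sw]
  simp only [AlgHom.comp_apply, Bialgebra.comulAlgHom_apply]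
  rw [← (ℛ k a).eq]
  simp [sw]

theorem part_ii [IsAlgClosed k] (hC : CommByFinite k A H ι)
    (hcore : ∀ m : Ideal A, m.IsMaximal → IsCore k A H ι m (core m))
    (horb : OrbSemi A core) (g h : A →ₐ[k] k) (f f' : Module.Dual k H)
    (hf : f ∈ ghat k A H ι core g) (hf' : f' ∈ ghat k A H ι core h) :
    conv k f f' ∈ Submodule.span k
        {x : Module.Dual k H | ∃ g' h' c : A →ₐ[k] k,
          core (RingHom.ker g') = core (RingHom.ker g) ∧
          core (RingHom.ker h') = core (RingHom.ker h) ∧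
          (∀ a : A, c a = conv k g'.toLinearMap h'.toLinearMap a) ∧
          x ∈ ghat k A H ι core c} := by
  classical
  obtain ⟨O, hO1, -, hO3⟩ := exists_orb hC hcore horb g
  obtain ⟨O', hO1', -, hO3'⟩ := exists_orb hC hcore horb h
  choose c hc using exists_prod (k := k) (A := A)
  have key : ∀ (g : A →ₐ[k] k) (O : Finset (A →ₐ[k] k)) (f : Module.Dual k H), 
     (∀ a, a ∈ core (RingHom.ker g) ↔ ∀ h ∈ O, h a = 0) → f ∈ ghat k A H ι core g →
     ∃ e : (A →ₐ[k] k) → A, ∀ y a, f (y * ι a) = ∑ p ∈ O, f (y * ι (e p)) * p a := by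
    intro g O f hO hf
    obtain ⟨e, he1, he2⟩ := exists_idem O
    refine ⟨e, fun y a => ?_⟩
    have : a - ∑ p ∈ O, p a • e p ∈ core (RingHom.ker g) := by
      rw [hO]
      intro q hq
      rw [map_sub, map_sum, Finset.sum_eq_single q]
      · simp [he1 q hq]
      · intro b _ hb
        simp [he2 b q hq hb]
      · intro hn; exact absurd hq hn
    have := (mem_ghat.1 hf) y _ this
    simp only [map_sub, map_sum, map_smul, mul_sub, Finset.mul_sum, mul_smul_comm, sub_eq_zero,
      smul_eq_mul] at this
    rw [this]
    exact Finset.sum_congr rfl fun _ _ => mul_comm _ _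
  obtain ⟨e, he⟩ := key g O f hO3 hf
  obtain ⟨e', he'⟩ := key h O' f' hO3' hf'
  have := mem_of_van hC hcore ((O ×ˢ O').image fun p => c p.1 p.2) (conv k f f') (by
    intro y a ha
    rw [conv_mul_iota hC]
    have z : ∀ y1 y2 : H, sw k (fun a1 a2 => f (y1 * ι a1) * f' (y2 * ι a2)) a = 0 := by
      intro y1 y2
      rw [sw_congr (k := k) (fun a1 a2 => show f (y1 * ι a1) * f' (y2 * ι a2) = _ by
        rw [he y1 a1, he' y2 a2, Finset.sum_mul_sum])]
      simp only [sw_sum]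
      refine Finset.sum_eq_zero fun p hp => Finset.sum_eq_zero fun q hq => ?_
      have h1 := ha (c p q) (Finset.mem_image.2 ⟨(p, q), Finset.mem_product.2 ⟨hp, hq⟩, rfl⟩)
      rw [hc, conv_eq_sw] at h1
      have h2 : ∀ x y, f (y1 * ι (e p)) * p x * (f' (y2 * ι (e' q)) * q y) =
        (f (y1 * ι (e p)) * f' (y2 * ι (e' q))) • (p x * q y) := by
        intro x y; rw [smul_eq_mul]; ring
      simp only [h2, ← sw_smul]
      rw [show sw k (fun x y => p x * q y) a = 0 from h1, smul_zero]
    simp only [z]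
    simp [sw])
  refine (show (⨆ g ∈ ((O ×ˢ O').image fun p => c p.1 p.2), ghat k A H ι core g) ≤ _ from
    iSup₂_le fun c' hc' => ?_) this
  obtain ⟨⟨p, q⟩, hpq, rfl⟩ := Finset.mem_image.1 hc'
  rw [Finset.mem_product] at hpq
  intro x hx
  exact Submodule.subset_span ⟨p, q, c p q, (hO1 p).1 hpq.1, (hO1' q).1 hpq.2, hc p q, hx⟩

theorem part_iii (hC : CommByFinite k A H ι) (g : A →ₐ[k] k) (t f : Module.Dual k H)
    (ht : t ∈ hbarStar k A H ι) (hf : f ∈ ghat k A H ι core g) :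
    conv k t f ∈ ghat k A H ι core g ∧ conv k f t ∈ ghat k A H ι core g := by
  have ht' : ∀ y a, t (y * ι a) = counit (R := k) a * t y := by
    intro y a
    have h1 : y * ι (a - algebraMap k A (counit (R := k) a)) ∈ augHIdeal k A H ι := by
      rw [aug_eq]
      exact left_le_right hC (aug_stable hC) (Submodule.subset_span ⟨y, _, sub_counit a, rfl⟩)
    have e := iota_sub' hC (Bialgebra.counitAlgHom k A) a y
    have := ht _ ((show y * ι a - counit (R := k) a • y = _ from e) ▸ h1)
    rw [map_sub, map_smul, sub_eq_zero] at this
    exact this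
  rw [mem_ghat] at hf
  constructor <;> rw [mem_ghat] <;> intro y a ha <;> rw [conv_mul_iota hC]
  · have : ∀ y1 y2 : H, sw k (fun a1 a2 => t (y1 * ι a1) * f (y2 * ι a2)) a = 0 := by
      intro y1 y2
      simp only [ht', mul_assoc]
      have := sw_counit_left (k := k) (G := fun a2 : A => t y1 * f (y2 * ι a2))
        (by constructor <;> intros <;> simp [mul_add, mul_left_comm]) a
      simp only [smul_eq_mul] at this
      rw [this, hf y2 a ha, mul_zero]
    simp only [this]
    simp [sw]
  · have : ∀ y1 y2 : H, sw k (fun a1 a2 => f (y1 * ι a1) * t (y2 * ι a2)) a = 0 := by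
      intro y1 y2
      simp only [ht']
      have := sw_counit_right (k := k) (G := fun a2 : A => t y2 * f (y1 * ι a2))
        (by constructor <;> intros <;> simp [mul_add, mul_left_comm]) a
      simp only [smul_eq_mul] at this
      rw [hf y1 a ha, mul_zero] at this
      rw [← this]
      apply sw_congr; intro x y; ring
    simp only [this]
    simp [sw]

theorem part_v [IsAlgClosed k] (hC : CommByFinite k A H ι)
    (hcore : ∀ m : Ideal A, m.IsMaximal → IsCore k A H ι m (core m))
    (horb : OrbSemi A core) (g : A →ₐ[k] k) : 
      ghat k A H ι core g
        = ⨆ h : {h : A →ₐ[k] k // core (RingHom.ker h) = core (RingHom.ker g)},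
            (leftMul k A H ι (RingHom.ker h.1)).dualAnnihilator ∧
      ghat k A H ι core g
        = ⨆ h : {h : A →ₐ[k] k // core (RingHom.ker h) = core (RingHom.ker g)},
            (rightMul k A H ι (RingHom.ker h.1)).dualAnnihilator := by
  obtain ⟨O, hO1, -, hO3⟩ := exists_orb hC hcore horb g
  obtain ⟨h1, h2, -, -⟩ := core_inf hC hcore g O hO3
  constructor
  · rw [ghat, h1, dualAnn_finset, iSup_subtype]
    simp only [hO1]
  · rw [ghat, h2, dualAnn_finset, iSup_subtype]
    simp only [hO1]

theorem core_two (hC : CommByFinite k A H ι)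
    (hcore : ∀ m : Ideal A, m.IsMaximal → IsCore k A H ι m (core m)) (s : Finset (A →ₐ[k] k)) (h : H) :
    ∀ x ∈ ⨅ g ∈ s, leftMul k A H ι (core (RingHom.ker g)),
      h * x ∈ ⨅ g ∈ s, leftMul k A H ι (core (RingHom.ker g)) ∧
      x * h ∈ ⨅ g ∈ s, leftMul k A H ι (core (RingHom.ker g)) := by
  intro x hx
  simp only [Submodule.mem_iInf] at *
  constructor
  · intro g hg
    exact mul_leftMul (hx g hg) h
  · intro g hg
    have := hx g hg
    rw [left_eq_right hC (core_stable hC hcore g)] at *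
    exact rightMul_mul this h

theorem part_i [IsAlgClosed k] (hC : CommByFinite k A H ι)
    (hcore : ∀ m : Ideal A, m.IsMaximal → IsCore k A H ι m (core m))
    (horb : OrbSemi A core) :
    charComp k A H ι core ⊆ finDual k H ∧
    convOne k ∈ charComp k A H ι core ∧
    (∀ f g, f ∈ charComp k A H ι core → g ∈ charComp k A H ι core →
      f + g ∈ charComp k A H ι core ∧ conv k f g ∈ charComp k A H ι core) ∧
    (∀ (c : k), ∀ f ∈ charComp k A H ι core, c • f ∈ charComp k A H ι core) ∧
    (∀ f ∈ charComp k A H ι core,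
      f ∘ₗ HopfAlgebra.antipode (R := k) ∈ charComp k A H ι core) ∧
    (∀ f ∈ charComp k A H ι core, ∃ (n : ℕ) (s t : Fin n → Module.Dual k H),
      (∀ i, s i ∈ charComp k A H ι core ∧ t i ∈ charComp k A H ι core) ∧
      ∀ x y : H, f (x * y) = ∑ i, s i x * t i y) := by
  classical
  have fd : ∀ s : Finset (A →ₐ[k] k),
      FiniteDimensional k (H ⧸ (⨅ g ∈ s, leftMul k A H ι (core (RingHom.ker g)))) := by
    intro s
    apply fd_iInf
    intro g _
    obtain ⟨O, hO1, -, hO3⟩ := exists_orb hC hcore horb g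
    exact (core_inf hC hcore g O hO3).2.2.1
  refine ⟨?_, ?_, ?_, ?_, ?_, ?_⟩
  · rintro f ⟨s, -, hs⟩
    exact ⟨_, fun h x hx => core_two hC hcore s h x hx, fun x hx => hs x hx, fd s⟩
  · rw [charComp_iff]
    refine (le_iSup (ghat k A H ι core) (Bialgebra.counitAlgHom k A)) ?_
    rw [mem_ghat]
    intro y a ha
    have : counit (R := k) a = 0 := core_le hcore _ ha
    simp [convOne, hC.ι_counit, this]
  · simp only [charComp_iff]
    intro f g hf hg
    refine ⟨add_mem hf hg, ?_⟩
    induction hf using Submodule.iSup_induction' with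
    | zero => rw [conv_zero_left]; exact zero_mem _
    | add x y _ _ hx hy => rw [conv_add_left]; exact add_mem hx hy
    | mem i x hx =>
      induction hg using Submodule.iSup_induction' with
      | zero => rw [conv_zero_right]; exact zero_mem _
      | add x y _ _ hx hy => rw [conv_add_right]; exact add_mem hx hy
      | mem j y hy =>
        refine Submodule.span_le.2 ?_ (part_ii hC hcore horb i j x y hx hy)
        rintro z ⟨_, _, c, _, _, _, hz⟩
        exact (le_iSup (ghat k A H ι core) c) hz
  · simp only [charComp_iff]
    intro c f hf
    exact Submodule.smul_mem _ _ hf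
  · simp only [charComp_iff]
    intro f hf
    induction hf using Submodule.iSup_induction' with
    | zero => rw [LinearMap.zero_comp]; exact zero_mem _
    | add x y _ _ hx hy => rw [LinearMap.add_comp]; exact add_mem hx hy
    | mem g f hf =>
      obtain ⟨O, hO1, -, hO3⟩ := exists_orb hC hcore horb g
      have := mem_of_van hC hcore (O.image fun h => h.comp (HopfAlgebra.antipodeAlgHom k A))
        (f ∘ₗ HopfAlgebra.antipode (R := k)) (by
        intro y a ha
        rw [LinearMap.comp_apply, HopfAlgebra.antipode_mul_antidistrib, ← hC.ι_antipode]
        have h1 : HopfAlgebra.antipode k a ∈ core (RingHom.ker g) := by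
          rw [hO3]
          intro h hh
          exact ha _ (Finset.mem_image_of_mem _ hh)
        rw [ghat, Submodule.mem_dualAnnihilator] at hf
        apply hf
        rw [left_eq_right hC (core_stable hC hcore g)]
        exact Submodule.subset_span ⟨_, _, h1, rfl⟩)
      exact (iSup₂_le fun c _ => le_iSup (ghat k A H ι core) c) this
  · rintro f ⟨s, hne, hs⟩
    set I := ⨅ g ∈ s, leftMul k A H ι (core (RingHom.ker g)) with hI
    have := fd s
    let b := Module.finBasis k (H ⧸ I)
    have := fun i => Submodule.mkQ_surjective I (b i)
    choose c hc using this
    refine ⟨_, fun i => b.coord i ∘ₗ I.mkQ, fun i => f ∘ₗ LinearMap.mulLeft k (c i), ?_, ?_⟩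
    · intro i
      refine ⟨⟨s, hne, fun x hx => ?_⟩, ⟨s, hne, fun x hx => ?_⟩⟩
      · rw [LinearMap.comp_apply, Submodule.mkQ_apply, (Submodule.Quotient.mk_eq_zero I).2 hx, map_zero]
      · exact hs _ (core_two hC hcore s _ x hx).1
    · intro x y
      have h1 : x - ∑ i, b.coord i (I.mkQ x) • c i ∈ I := by
        refine (Submodule.Quotient.mk_eq_zero I).1 ?_
        change I.mkQ _ = 0
        rw [map_sub, map_sum, sub_eq_zero]
        simp only [map_smul, hc]
        exact (b.sum_repr (I.mkQ x)).symm
      have h2 := hs _ (core_two hC hcore s y _ h1).2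
      rw [sub_mul, map_sub, sub_eq_zero] at h2
      rw [h2]
      simp [Finset.sum_mul]

end Parts
end
end Paper


open TensorProduct LinearMap Coalgebra

namespace Paper

noncomputable section
set_option linter.all false
section UU
variable {k : Type} [Field k]
variable {V W N : Type} [AddCommGroup V] [Module k V] [AddCommGroup W] [Module k W]
  [AddCommGroup N] [Module k N]

def UU (P : Submodule k V) (Q : Submodule k W) : Submodule k (V ⊗[k] W) :=
  LinearMap.range (TensorProduct.map P.subtype LinearMap.id) ⊔
    LinearMap.range (TensorProduct.map LinearMap.id Q.subtype)

theorem UU_l {P : Submodule k V} {Q : Submodule k W} {x : V} (hx : x ∈ P) (y : W) :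
    x ⊗ₜ[k] y ∈ UU P Q :=
  Submodule.mem_sup_left ⟨(⟨x, hx⟩ : P) ⊗ₜ[k] y, by simp⟩

theorem UU_r {P : Submodule k V} {Q : Submodule k W} (x : V) {y : W} (hy : y ∈ Q) :
    x ⊗ₜ[k] y ∈ UU P Q :=
  Submodule.mem_sup_right ⟨x ⊗ₜ[k] (⟨y, hy⟩ : Q), by simp⟩

theorem UU_le {P : Submodule k V} {Q : Submodule k W} {R : Submodule k (V ⊗[k] W)}
    (h1 : ∀ x ∈ P, ∀ y, x ⊗ₜ[k] y ∈ R) (h2 : ∀ x, ∀ y ∈ Q, x ⊗ₜ[k] y ∈ R) : UU P Q ≤ R := by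
  refine sup_le ?_ ?_
  · rintro _ ⟨t, rfl⟩
    induction t using TensorProduct.induction_on with
    | zero => rw [map_zero]; exact zero_mem _
    | tmul x y => exact h1 x.1 x.2 y
    | add x y hx hy => rw [map_add]; exact add_mem hx hy
  · rintro _ ⟨t, rfl⟩
    induction t using TensorProduct.induction_on with
    | zero => rw [map_zero]; exact zero_mem _
    | tmul x y => exact h2 x y.1 y.2
    | add x y hx hy => rw [map_add]; exact add_mem hx hy

theorem UU_le_comap {P : Submodule k V} {Q : Submodule k W} {R : Submodule k N}
    (L : V ⊗[k] W →ₗ[k] N)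
    (h1 : ∀ x ∈ P, ∀ y, L (x ⊗ₜ[k] y) ∈ R) (h2 : ∀ x, ∀ y ∈ Q, L (x ⊗ₜ[k] y) ∈ R) :
    ∀ t ∈ UU P Q, L t ∈ R :=
  UU_le (R := R.comap L) h1 h2

theorem UU_finrank (P : Submodule k V) (Q : Submodule k W) :
    Module.finrank k ((V ⊗[k] W) ⧸ UU P Q) = Module.finrank k (V ⧸ P) * Module.finrank k (W ⧸ Q) := by
  rw [← Module.finrank_tensorProduct]
  exact (TensorProduct.quotientTensorQuotientEquiv P Q).finrank_eq.symm

theorem UU_fd (P : Submodule k V) (Q : Submodule k W) [FiniteDimensional k (V ⧸ P)]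
    [FiniteDimensional k (W ⧸ Q)] : FiniteDimensional k ((V ⊗[k] W) ⧸ UU P Q) :=
  Module.Finite.equiv (TensorProduct.quotientTensorQuotientEquiv P Q)

theorem tens_all {R : Submodule k N} (L : V ⊗[k] W →ₗ[k] N) (h : ∀ x y, L (x ⊗ₜ[k] y) ∈ R) :
    ∀ t, L t ∈ R := by
  intro t
  induction t using TensorProduct.induction_on with
  | zero => rw [map_zero]; exact zero_mem _
  | tmul x y => exact h x y
  | add x y hx hy => rw [map_add]; exact add_mem hx hy
end UU

section Gal
variable {k : Type} [Field k]
variable {A : Type} [CommRing A] [HopfAlgebra k A]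
variable {H : Type} [Ring H] [HopfAlgebra k H]
variable {ι : A →ₗ[k] H}

/-- Galois map -/
def gal (T : H →ₗ[k] H) : H ⊗[k] H →ₗ[k] H ⊗[k] H :=
  (TensorProduct.map (LinearMap.mul' k H ∘ₗ TensorProduct.map LinearMap.id T) LinearMap.id) ∘ₗ
  (TensorProduct.assoc k H H H).symm.toLinearMap ∘ₗ TensorProduct.map LinearMap.id comul

theorem gal_tmul (T : H →ₗ[k] H) (x y : H) :
    gal T (x ⊗ₜ[k] y) = sw k (fun y1 y2 => (x * T y1) ⊗ₜ[k] y2) y := by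
  simp only [gal, LinearMap.comp_apply, TensorProduct.map_tmul]
  conv_lhs => rw [← (ℛ k y).eq]
  simp [sw, tmul_sum]

local notation "β" => gal (k := k) (H := H) LinearMap.id
local notation "γ" => gal (k := k) (H := H) (HopfAlgebra.antipode k)

theorem gal_inv1 (t : H ⊗[k] H) : β (γ t) = t := by
  induction t using TensorProduct.induction_on with
  | zero => simp
  | add x y hx hy => rw [map_add, map_add, hx, hy]
  | tmul x y =>
    rw [gal_tmul, map_sw]
    simp only [gal_tmul, LinearMap.id_apply]
    rw [← sw_coassoc (F := fun u v z => (x * HopfAlgebra.antipode k u * v) ⊗ₜ[k] z)]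
    · have : ∀ u z : H, sw k (fun u v => (x * HopfAlgebra.antipode k u * v) ⊗ₜ[k] z) u =
        counit (R := k) u • (x ⊗ₜ[k] z) := by
        intro u z
        have := sw_S_left (k := k) (G := fun w : H => (x * w) ⊗ₜ[k] z)
          (by constructor <;> intros <;> simp [mul_add, add_tmul, smul_tmul']) u
        simpa [mul_assoc] using this
      simp only [this]
      exact sw_counit_left (by constructor <;> intros <;> simp [tmul_add]) y
    · constructor <;> intros <;> constructor <;> intros <;>
        simp [mul_add, add_mul, tmul_add, add_tmul, smul_tmul']

theorem gal_inv2 (t : H ⊗[k] H) : γ (β t) = t := by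
  induction t using TensorProduct.induction_on with
  | zero => simp
  | add x y hx hy => rw [map_add, map_add, hx, hy]
  | tmul x y =>
    rw [gal_tmul, map_sw]
    simp only [gal_tmul, LinearMap.id_apply]
    rw [← sw_coassoc (F := fun u v z => (x * u * HopfAlgebra.antipode k v) ⊗ₜ[k] z)]
    · have : ∀ u z : H, sw k (fun u v => (x * u * HopfAlgebra.antipode k v) ⊗ₜ[k] z) u =
        counit (R := k) u • (x ⊗ₜ[k] z) := by
        intro u z
        have := sw_S_right (k := k) (G := fun w : H => (x * w) ⊗ₜ[k] z)
          (by constructor <;> intros <;> simp [mul_add, add_tmul, smul_tmul']) u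
        simpa [mul_assoc] using this
      simp only [this]
      exact sw_counit_left (by constructor <;> intros <;> simp [tmul_add]) y
    · constructor <;> intros <;> constructor <;> intros <;>
        simp [mul_add, add_mul, tmul_add, add_tmul, smul_tmul']

/-- dimension of the pairing -/
def nn (k : Type) [Field k] (A : Type) [CommRing A] [HopfAlgebra k A] (H : Type) [Ring H]
    [HopfAlgebra k H] (ι : A →ₗ[k] H) (g h : A →ₐ[k] k) : ℕ :=
  Module.finrank k (H ⧸ (rightMul k A H ι (RingHom.ker g) ⊔ leftMul k A H ι (RingHom.ker h)))

def dd (k : Type) [Field k] (A : Type) [CommRing A] [HopfAlgebra k A] (H : Type) [Ring H]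
    [HopfAlgebra k H] (ι : A →ₗ[k] H) (g : A →ₐ[k] k) : ℕ :=
  Module.finrank k (H ⧸ (rightMul k A H ι (RingHom.ker g)))

theorem rightMul_iota (hC : CommByFinite k A H ι) {J : Ideal A} {x : H}
    (hx : x ∈ rightMul k A H ι J) (b : A) : ι b * x ∈ rightMul k A H ι J := by
  have : rightMul k A H ι J ≤ (rightMul k A H ι J).comap (LinearMap.mulLeft k (ι b)) := by
    conv_lhs => rw [rightMul]
    rw [Submodule.span_le]
    rintro _ ⟨y, a, ha, rfl⟩
    refine Submodule.subset_span ⟨y, b * a, J.mul_mem_left _ ha, ?_⟩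
    simp [hC.ι_mul, mul_assoc]
  exact this hx

theorem leftMul_iota (hC : CommByFinite k A H ι) {J : Ideal A} {x : H}
    (hx : x ∈ leftMul k A H ι J) (b : A) : x * ι b ∈ leftMul k A H ι J := by
  have : leftMul k A H ι J ≤ (leftMul k A H ι J).comap (LinearMap.mulRight k (ι b)) := by
    conv_lhs => rw [leftMul]
    rw [Submodule.span_le]
    rintro _ ⟨y, a, ha, rfl⟩
    refine Submodule.subset_span ⟨y, a * b, J.mul_mem_right _ ha, ?_⟩
    simp [hC.ι_mul, mul_assoc]
  exact this hx

theorem galois_count (hC : CommByFinite k A H ι) (g : A →ₐ[k] k) (O : Finset (A →ₐ[k] k)) (J : Ideal A)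
    (hJ : ∀ a, a ∈ J ↔ ∀ h ∈ O, h a = 0) (hst : ∀ h, ∀ a ∈ J, act hC h a ∈ J)
    (hJg : J ≤ RingHom.ker g) :
    ∑ h ∈ O, nn k A H ι g h * dd k A H ι h =
      dd k A H ι g * Module.finrank k (H ⧸ augHIdeal k A H ι) := by
  classical
  obtain ⟨e, he1, he2⟩ := exists_idem O
  set K := augHIdeal k A H ι with hK
  set P := rightMul k A H ι (RingHom.ker g) with hP
  have hKA : ∀ (b : A) (z : H), ι b * z - counit (R := k) b • z ∈ K := by
    intro b z
    rw [show ι b * z - counit (R := k) b • z = _ from iota_sub hC (Bialgebra.counitAlgHom k A) b z,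
      hK, aug_eq]
    exact Submodule.subset_span ⟨z, _, sub_counit b, rfl⟩
  have hJP : leftMul k A H ι J ≤ P := by
    rw [left_eq_right hC hst]; exact rightMul_mono hJg
  have hHJ : ∀ x y a, a ∈ J → x * ι a * y ∈ P := by
    intro x y a ha
    exact rightMul_mul (hJP (Submodule.subset_span ⟨x, a, ha, rfl⟩)) y
  let Q := (UU P K).comap β
  let Qh : (A →ₐ[k] k) → Submodule k (H ⊗[k] H) := fun h =>
    UU (P ⊔ leftMul k A H ι (RingHom.ker h)) (rightMul k A H ι (RingHom.ker h))
  let E : (A →ₐ[k] k) → H ⊗[k] H →ₗ[k] H ⊗[k] H := fun h =>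
    TensorProduct.map (LinearMap.mulRight k (ι (e h))) LinearMap.id
  have hE : ∀ h x y, E h (x ⊗ₜ[k] y) = (x * ι (e h)) ⊗ₜ[k] y := by
    intro h x y; simp [E]
  have eJ : ∀ h ∈ O, ∀ a, h a = 0 → e h * a ∈ J := by
    intro h hh a ha
    rw [hJ]
    intro h' hh'
    rw [map_mul]
    by_cases hb : h = h'
    · subst hb; rw [ha, mul_zero]
    · rw [he2 h h' hh' hb, zero_mul]
  have h1 : ∀ h ∈ O, Q ≤ Qh h := by
    intro h hh t ht
    rw [← gal_inv2 t]
    refine UU_le_comap (R := Qh h) γ ?_ ?_ (β t) ht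
    · intro x hx y
      rw [gal_tmul]
      refine sw_mem _ _ _ fun y1 y2 => UU_l ?_ _
      exact Submodule.mem_sup_left (rightMul_mul hx _)
    · intro x y hy
      have : K ≤ (Qh h).comap (γ ∘ₗ TensorProduct.mk k H H x) := by
        rw [hK, augHIdeal, Submodule.span_le]
        rintro _ ⟨a, z, ha, rfl⟩
        change γ (x ⊗ₜ[k] (ι a * z)) ∈ Qh h
        have hq : ∀ (w z : H) (b c : A), (w * ι b) ⊗ₜ[k] (ι c * z) - (h b * h c) • (w ⊗ₜ[k] z) ∈ Qh h := by
          intro w z b c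
          have : (w * ι b) ⊗ₜ[k] (ι c * z) - (h b * h c) • (w ⊗ₜ[k] z) =
            (w * ι b - h b • w) ⊗ₜ[k] (ι c * z) + (h b • w) ⊗ₜ[k] (ι c * z - h c • z) := by
            simp only [sub_tmul, tmul_sub, tmul_smul, smul_tmul', mul_smul, smul_comm (h c) (h b)]
            abel
          rw [this]
          refine add_mem (UU_l ?_ _) (UU_r _ ?_)
          · rw [iota_sub' hC]
            exact Submodule.mem_sup_right (Submodule.subset_span ⟨w, _, sub_mem_ker h b, rfl⟩)
          · rw [iota_sub hC]
            exact Submodule.subset_span ⟨z, _, sub_mem_ker h c, rfl⟩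
        rw [gal_tmul, sw_mul, sw_iota hC]
        · have e0 : sw k (fun a1 a2 => sw k (fun z1 z2 => (h (HopfAlgebra.antipode k a1) * h a2) •
              ((x * HopfAlgebra.antipode k z1) ⊗ₜ[k] z2)) z) a = 0 := by
            simp only [← sw_smul, ← map_mul]
            have := sw_S_left (k := k) (G := fun w : A => (h w) •
              sw k (fun z1 z2 => (x * HopfAlgebra.antipode k z1) ⊗ₜ[k] z2) z)
              (by constructor <;> intros <;> simp [add_smul, mul_smul]) a
            rw [this, ha, zero_smul]
          rw [← sub_zero (sw k _ a), ← e0]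
          simp only [sw]
          rw [← Finset.sum_sub_distrib]
          refine sum_mem fun i _ => ?_
          rw [← Finset.sum_sub_distrib]
          refine sum_mem fun j _ => ?_
          rw [HopfAlgebra.antipode_mul_antidistrib, ← hC.ι_antipode, ← mul_assoc]
          exact hq _ _ _ _
        · constructor <;> intros <;> constructor <;> intros <;>
            simp [mul_add, add_mul, tmul_add, add_tmul, smul_tmul', sw_add, sw_smul]
        · constructor <;> intros <;> constructor <;> intros <;>
            simp [mul_add, add_mul, tmul_add, add_tmul, smul_tmul']
      exact this hy
  have h2 : ∀ h ∈ O, ∀ x ∈ Qh h, E h x ∈ Q := by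
    intro h hh
    refine UU_le_comap (R := Q) (E h) ?_ ?_
    · intro x hx y
      rw [hE]
      change β _ ∈ UU P K
      rw [gal_tmul]
      refine sw_mem _ _ _ fun y1 y2 => UU_l ?_ _
      refine rightMul_mul ?_ _
      have : P ⊔ leftMul k A H ι (RingHom.ker h) ≤ P.comap (LinearMap.mulRight k (ι (e h))) := by
        refine sup_le ?_ ?_
        · intro x hx
          exact rightMul_mul hx _
        · rw [leftMul, Submodule.span_le]
          rintro _ ⟨x, a, ha, rfl⟩
          have := hHJ x 1 _ (eJ h hh a ha)
          simpa [mul_assoc, ← hC.ι_mul, mul_comm] using this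
      exact this hx
    · intro x y hy
      have : rightMul k A H ι (RingHom.ker h) ≤ Q.comap (E h ∘ₗ TensorProduct.mk k H H x) := by
        rw [rightMul, Submodule.span_le]
        rintro _ ⟨z, b, hb, rfl⟩
        change E h (x ⊗ₜ[k] (ι b * z)) ∈ Q
        rw [hE]
        change β _ ∈ UU P K
        rw [gal_tmul, sw_mul, sw_iota hC]
        · have e0 : sw k (fun a1 a2 => sw k (fun z1 z2 => counit (R := k) a2 •
              ((x * ι (e h) * (ι a1 * z1)) ⊗ₜ[k] z2)) z) b =
              sw k (fun z1 z2 => ((x * ι (e h) * (ι b * z1)) ⊗ₜ[k] z2)) z := by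
            simp only [← sw_smul]
            exact sw_counit_right (k := k) (G := fun a1 : A => 
              sw k (fun z1 z2 => (x * ι (e h) * (ι a1 * z1)) ⊗ₜ[k] z2) z)
              (by constructor <;> intros <;> 
                simp [mul_add, add_mul, tmul_add, add_tmul, smul_tmul', sw_add, sw_smul]) b
          have e1 : sw k (fun z1 z2 => ((x * ι (e h) * (ι b * z1)) ⊗ₜ[k] z2)) z ∈ UU P K := by
            refine sw_mem _ _ _ fun y1 y2 => UU_l ?_ _
            have := hHJ x y1 _ (eJ h hh b hb)
            simpa [mul_assoc, hC.ι_mul] using this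
          rw [← e0] at e1
          refine (Submodule.sub_mem_iff_left _ e1).1 ?_
          simp only [sw]
          rw [← Finset.sum_sub_distrib]
          refine sum_mem fun i _ => ?_
          rw [← Finset.sum_sub_distrib]
          refine sum_mem fun j _ => ?_
          rw [← tmul_smul, LinearMap.id_apply, ← tmul_sub]
          exact UU_r _ (hKA _ _)
        · constructor <;> intros <;> constructor <;> intros <;>
            simp [mul_add, add_mul, tmul_add, add_tmul, smul_tmul', sw_add, sw_smul]
        · constructor <;> intros <;> constructor <;> intros <;>
            simp [mul_add, add_mul, tmul_add, add_tmul, smul_tmul']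
      exact this hy
  have h3 : ∀ x, x - ∑ h ∈ O, E h x ∈ Q := by
    have := tens_all (R := Q) (LinearMap.id - ∑ h ∈ O, E h) (by
      intro x y
      have hx : (LinearMap.id - ∑ h ∈ O, E h : H ⊗[k] H →ₗ[k] H ⊗[k] H) (x ⊗ₜ[k] y) = (x * ι (1 - ∑ h ∈ O, e h)) ⊗ₜ[k] y := by
        simp [hE, mul_sub, hC.ι_one, sub_tmul, Finset.mul_sum, sum_tmul]
      rw [hx]
      change β _ ∈ UU P K
      rw [gal_tmul]
      refine sw_mem _ _ _ fun y1 y2 => UU_l ?_ _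
      apply hHJ
      rw [hJ]
      intro h hh
      rw [map_sub, map_one, map_sum, Finset.sum_eq_single h, he1 h hh, sub_self]
      · intro b hb hbh
        exact he2 b h hh hbh
      · intro hn; exact absurd hh hn)
    intro x
    simpa using this x
  have h4 : ∀ h ∈ O, ∀ x, E h x - x ∈ Qh h := by
    intro h hh x
    have := tens_all (R := Qh h) (E h - LinearMap.id) (by
      intro x y
      have hx : (E h - LinearMap.id : H ⊗[k] H →ₗ[k] H ⊗[k] H) (x ⊗ₜ[k] y) = (x * ι (e h - 1)) ⊗ₜ[k] y := by
        simp [hE, mul_sub, hC.ι_one, sub_tmul]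
      rw [hx]
      have z : x * ι (e h - 1) ∈ leftMul k A H ι (RingHom.ker h) :=
        Submodule.subset_span ⟨x, e h - 1, by
          rw [RingHom.mem_ker, map_sub, map_one, he1 h hh, sub_self], rfl⟩
      exact UU_l (Submodule.mem_sup_right z) _)
    simpa using this x
  have h5 : ∀ h ∈ O, ∀ h' ∈ O, h ≠ h' → ∀ x, E h x ∈ Qh h' := by
    intro h hh h' hh' hn
    refine tens_all (R := Qh h') (E h) (by
      intro x y
      rw [hE]
      have z : x * ι (e h) ∈ leftMul k A H ι (RingHom.ker h') :=
        Submodule.subset_span ⟨x, e h, he2 h h' hh' hn, rfl⟩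
      exact UU_l (Submodule.mem_sup_right z) _)
  have fd : ∀ h, FiniteDimensional k ((H ⊗[k] H) ⧸ Qh h) := by
    intro h
    have := fin_aux hC (P ⊔ leftMul k A H ι (RingHom.ker h)) g le_sup_left
    have := fin_aux hC (rightMul k A H ι (RingHom.ker h)) h le_rfl
    exact UU_fd _ _
  have key := (crt_finrank O E Q Qh h1 h2 h3 h4 h5).2
  have hs : Function.Surjective β := fun t => ⟨γ t, gal_inv1 t⟩
  have eq : Module.finrank k ((H ⊗[k] H) ⧸ Q) = Module.finrank k ((H ⊗[k] H) ⧸ UU P K) := by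
    let f := (UU P K).mkQ ∘ₗ β
    have hf : Function.Surjective f := (Submodule.mkQ_surjective _).comp hs
    have hk : LinearMap.ker f = Q := by
      rw [LinearMap.ker_comp, Submodule.ker_mkQ]
    rw [← hk]
    exact (f.quotKerEquivOfSurjective hf).finrank_eq
  rw [eq, UU_finrank] at key
  rw [dd, key]
  refine Finset.sum_congr rfl fun h _ => ?_
  rw [nn, dd, UU_finrank]

end Gal
end
end Paper


open TensorProduct LinearMap Coalgebra

namespace Paper

noncomputable section
set_option linter.all false
section Growth
variable {k : Type} [Field k]
variable {A : Type} [CommRing A] [HopfAlgebra k A]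
variable {H : Type} [Ring H] [HopfAlgebra k H]
variable {ι : A →ₗ[k] H}

theorem pow_span_le {d : ℕ} (v : Fin d → A) (n : ℕ) :
    (Submodule.span k (Set.range v)) ^ n ≤ 
      Submodule.span k {x : A | ∃ e : Fin d → ℕ, (∀ i, e i ≤ n) ∧ x = ∏ i, v i ^ e i} := by
  classical
  induction n with
  | zero =>
    rw [pow_zero, Submodule.one_eq_span, Submodule.span_le, Set.singleton_subset_iff]
    exact Submodule.subset_span ⟨fun _ => 0, fun _ => le_rfl, by simp⟩
  | succ n ih =>
    rw [pow_succ]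
    refine (mul_le_mul' ih le_rfl).trans ?_
    rw [Submodule.span_mul_span, Submodule.span_le]
    rintro _ ⟨_, ⟨e, he, rfl⟩, _, ⟨j, rfl⟩, rfl⟩
    refine Submodule.subset_span ⟨fun i => e i + if i = j then 1 else 0, fun i => ?_, ?_⟩
    · have := he i
      dsimp only
      split_ifs <;> omega
    · simp only [pow_add, Finset.prod_mul_distrib, Finset.prod_pow_boole]
      simp

theorem pow_span_finrank {d : ℕ} (v : Fin d → A) (n : ℕ) :
    Module.finrank k ↥((Submodule.span k (Set.range v)) ^ n) ≤ (n + 1) ^ d := by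
  classical
  let w : (Fin d → Fin (n + 1)) → A := fun e => ∏ i, v i ^ (e i : ℕ)
  have h1 : (Submodule.span k (Set.range v)) ^ n ≤ Submodule.span k (Set.range w) := by
    refine (pow_span_le v n).trans (Submodule.span_mono ?_)
    rintro _ ⟨e, he, rfl⟩
    exact ⟨fun i => ⟨e i, Nat.lt_succ_of_le (he i)⟩, rfl⟩
  have : FiniteDimensional k (Submodule.span k (Set.range w)) :=
    FiniteDimensional.span_of_finite k (Set.finite_range w)
  refine (Submodule.finrank_mono h1).trans ((finrank_range_le_card (R := k) w).trans ?_)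
  simp

theorem no_exp (D d : ℕ) (a : ℕ → ℕ) (h0 : 0 < a 0) (h1 : ∀ n, D * a n ≤ (D - 1) * a (n + 1))
    (hD : 0 < D) (h2 : ∀ n, a n ≤ (n + 1) ^ d) : False := by
  have h3 : ∀ n, D ^ n ≤ (D - 1) ^ n * a n := by
    intro n
    induction n with
    | zero => rw [pow_zero, pow_zero, one_mul]; exact h0
    | succ n ih =>
      calc D ^ (n + 1) = D ^ n * D := pow_succ _ _
        _ ≤ (D - 1) ^ n * a n * D := Nat.mul_le_mul_right _ ih
        _ = (D - 1) ^ n * (D * a n) := by ring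
        _ ≤ (D - 1) ^ n * ((D - 1) * a (n + 1)) := Nat.mul_le_mul_left _ (h1 n)
        _ = _ := by ring
  rcases Nat.lt_or_ge D 2 with h | h
  · have : D = 1 := by omega
    subst this
    have := h1 0
    simp at this; omega
  · set r : ℝ := ((D - 1 : ℕ) : ℝ) / D with hr
    have hDpos : (0 : ℝ) < D := by exact_mod_cast hD
    have hr0 : 0 < r := by
      have : (0 : ℝ) < ((D - 1 : ℕ) : ℝ) := by exact_mod_cast (by omega : 0 < D - 1)
      positivity
    have hr1 : r < 1 := by
      rw [hr, div_lt_one hDpos]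
      exact_mod_cast (by omega : D - 1 < D)
    have ht := tendsto_pow_const_mul_const_pow_of_abs_lt_one d (r := r) (by rw [abs_of_pos hr0]; exact hr1)
    have hev := (ht.comp (Filter.tendsto_add_atTop_nat 1)).eventually (gt_mem_nhds hr0)
    obtain ⟨n, hn⟩ := hev.exists
    simp only [Function.comp] at hn
    have h4 : (1 : ℝ) ≤ r ^ n * (n + 1 : ℝ) ^ d := by
      have h5 : ((D ^ n : ℕ) : ℝ) ≤ (((D - 1) ^ n * (n + 1) ^ d : ℕ) : ℝ) := by
        exact_mod_cast (h3 n).trans (Nat.mul_le_mul_left _ (h2 n))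
      rw [Nat.cast_mul, Nat.cast_pow, Nat.cast_pow, Nat.cast_pow] at h5
      rw [hr, div_pow, div_mul_eq_mul_div, le_div_iff₀ (by positivity), one_mul]
      push_cast at h5 ⊢
      exact h5
    have h6 : ((n + 1 : ℕ) : ℝ) ^ d * r ^ (n + 1) = r * (r ^ n * (n + 1 : ℝ) ^ d) := by
      push_cast; ring
    rw [h6] at hn
    nlinarith

theorem finrank_fin_fun' (D : ℕ) {W : Type} [AddCommGroup W] [Module k W] [FiniteDimensional k W] :
    Module.finrank k (Fin D → W) = D * Module.finrank k W := by
  rw [Module.finrank_pi_fintype, Finset.sum_const, Finset.card_univ, Fintype.card_fin, smul_eq_mul]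

theorem exists_core_elt [IsDomain A] (hC : CommByFinite k A H ι) (f : A) (hf : f ≠ 0) :
    ∃ a : A, a ≠ 0 ∧ ∀ x : H, act hC x a ∈ Ideal.span {f} := by
  classical
  by_contra hcon
  push Not at hcon
  have fdK : FiniteDimensional k (H ⧸ augHIdeal k A H ι) := fin_K hC
  obtain ⟨D, ⟨b⟩⟩ : ∃ D, Nonempty (Module.Basis (Fin D) k (H ⧸ augHIdeal k A H ι)) :=
    ⟨_, ⟨Module.finBasis k (H ⧸ augHIdeal k A H ι)⟩⟩
  have := fun i => Submodule.mkQ_surjective (augHIdeal k A H ι) (b i)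
  choose c hc using this
  have hact : ∀ x a, act hC x a = ∑ i, b.coord i ((augHIdeal k A H ι).mkQ x) • act hC (c i) a := by
    intro x a
    have h1 : x - ∑ i, b.coord i ((augHIdeal k A H ι).mkQ x) • c i ∈ augHIdeal k A H ι := by
      refine (Submodule.Quotient.mk_eq_zero _).1 ?_
      change (augHIdeal k A H ι).mkQ _ = 0
      rw [map_sub, map_sum, sub_eq_zero]
      simp only [map_smul, hc]
      exact (b.sum_repr _).symm
    have h2 : (actL hC).flip a (x - ∑ i, b.coord i ((augHIdeal k A H ι).mkQ x) • c i) = 0 := by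
      rw [LinearMap.flip_apply, actL_apply]; exact act_KI hC h1 a
    rw [map_sub, map_sum, sub_eq_zero] at h2
    simpa only [LinearMap.flip_apply, actL_apply, map_smul] using h2
  let w : Fin D × Bool → A := fun p => act hC (c p.1) (if p.2 then 1 else f)
  let eq := Fintype.equivFin (Fin D × Bool)
  let v := w ∘ eq.symm
  set V := Submodule.span k (Set.range v) with hV
  have hVw : V = Submodule.span k (Set.range w) := by
    rw [hV, show Set.range v = Set.range w from eq.symm.surjective.range_comp w]
  have hVm : ∀ x (t : Bool), act hC x (if t then 1 else f) ∈ V := by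
    intro x t
    rw [hact, hVw]
    exact sum_mem fun i _ => Submodule.smul_mem _ _ (Submodule.subset_span ⟨(i, t), rfl⟩)
  have h1V : (1 : A) ∈ V := by simpa [act_one_left] using hVm 1 true
  have hfV : f ∈ V := by simpa [act_one_left] using hVm 1 false
  have hVst : ∀ x, ∀ a ∈ V, act hC x a ∈ V := by
    intro x
    have : V ≤ V.comap (actL hC x) := by
      conv_lhs => rw [hVw]
      rw [Submodule.span_le]
      rintro _ ⟨p, rfl⟩
      change act hC x (act hC _ _) ∈ V
      rw [← act_mul_left]
      exact hVm _ _
    exact this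
  have hst : ∀ n, ∀ x, ∀ a ∈ V ^ n, act hC x a ∈ V ^ n := by
    intro n
    induction n with
    | zero =>
      intro x a ha
      rw [pow_zero] at *
      obtain ⟨y, rfl⟩ := Submodule.mem_one.1 ha
      rw [Algebra.algebraMap_eq_smul_one, ← actL_apply, map_smul, actL_apply]
      refine Submodule.smul_mem _ _ ?_
      have : act hC x 1 = counit (R := k) x • 1 := by
        apply hC.ι_inj
        rw [iota_act, hC.ι_one, adl_eq_sw, map_smul, hC.ι_one]
        simp only [mul_one]
        exact sw_S_right (G := fun z : H => z) (by constructor <;> intros <;> simp) x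
      rw [this]
      exact Submodule.smul_mem _ _ (Submodule.one_le.1 le_rfl)
    | succ n ih =>
      intro x
      have : V ^ n * V ≤ (V ^ n * V).comap (actL hC x) := by
        rw [Submodule.mul_le]
        intro y hy z hz
        rw [Submodule.mem_comap, actL_apply, act_mul_right]
        exact sw_mem _ _ _ fun _ _ => Submodule.mul_mem_mul (ih _ _ hy) (hVst _ _ hz)
      rw [pow_succ]
      exact this
  have fdV : ∀ n, FiniteDimensional k ↥(V ^ n) := by
    intro n
    rw [FiniteDimensional, Module.Finite.iff_fg]
    exact (Submodule.fg_span (Set.finite_range v)).pow n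
  have hD0 : 0 < D := by
    rcases Nat.eq_zero_or_pos D with h | h
    · exfalso
      have : IsEmpty (Fin D) := by rw [h]; infer_instance
      have := hact 1 1
      rw [act_one_left] at this
      simp at this
    · exact h
  refine no_exp D _ (fun n => Module.finrank k ↥(V ^ n)) ?_ ?_ hD0 (pow_span_finrank v)
  · have := fdV 0
    rw [Module.finrank_pos_iff_exists_ne_zero]
    exact ⟨⟨1, by rw [pow_zero]; exact Submodule.one_le.1 le_rfl⟩, fun h => one_ne_zero (congrArg Subtype.val h)⟩
  · intro n
    let W := V ^ (n + 1)
    let F : Submodule k A := (Ideal.span {f}).restrictScalars k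
    let L : ↥(V ^ n) →ₗ[k] ↥W := (LinearMap.mulLeft k f).restrict (by
      intro x hx
      change f * x ∈ V ^ (n + 1)
      rw [pow_succ']
      exact Submodule.mul_mem_mul hfV hx)
    have hLi : Function.Injective L := by
      intro x y hxy
      have : f * x.1 = f * y.1 := congrArg Subtype.val hxy
      exact Subtype.ext (mul_left_cancel₀ hf this)
    let G : Submodule k ↥W := F.comap W.subtype
    have hLG : LinearMap.range L ≤ G := by
      rintro _ ⟨x, rfl⟩
      change f * x.1 ∈ Ideal.span {f}
      exact Ideal.mul_mem_right _ _ (Ideal.subset_span rfl)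
    have h5 : Module.finrank k ↥(V ^ n) ≤ Module.finrank k G := by
      rw [← LinearMap.finrank_range_of_inj hLi]
      exact Submodule.finrank_mono hLG
    let Φ : ↥W →ₗ[k] (Fin D → ↥W ⧸ G) := LinearMap.pi fun i =>
      G.mkQ ∘ₗ (actL hC (c i)).restrict (p := W) (q := W) (hst (n + 1) (c i))
    have hΦ : Function.Injective Φ := by
      rw [← LinearMap.ker_eq_bot, LinearMap.ker_eq_bot']
      intro x hx
      by_contra hne
      obtain ⟨y, hy⟩ := hcon x.1 (fun h => hne (Subtype.ext h))
      apply hy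
      rw [hact]
      refine sum_mem fun i _ => ?_
      refine F.smul_mem _ ?_
      have := congrFun hx i
      exact (Submodule.Quotient.mk_eq_zero G).1 this
    have h6 := LinearMap.finrank_le_finrank_of_injective hΦ
    have fdW : FiniteDimensional k W := fdV (n + 1)
    have fdQ : FiniteDimensional k (W ⧸ G) := Module.Finite.of_surjective G.mkQ (Submodule.mkQ_surjective G)
    rw [finrank_fin_fun' D] at h6
    have h7 := Submodule.finrank_quotient_add_finrank G
    change D * _ ≤ (D - 1) * Module.finrank k W
    obtain ⟨D', hD'⟩ : ∃ D', D = D' + 1 := ⟨D - 1, by omega⟩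
    rw [hD'] at h6 ⊢
    simp only [Nat.add_sub_cancel]
    nlinarith

end Growth
end
end Paper


open TensorProduct LinearMap Coalgebra

namespace Paper

noncomputable section
set_option linter.all false
section Fib
variable {k : Type} [Field k]
variable {A : Type} [CommRing A] [HopfAlgebra k A]
variable {H : Type} [Ring H] [HopfAlgebra k H]
variable {ι : A →ₗ[k] H}
variable {core : Ideal A → Ideal A}

def iR (hC : CommByFinite k A H ι) : A →+* H where
  toFun := ι
  map_one' := hC.ι_one
  map_mul' := hC.ι_mul
  map_zero' := map_zero ι
  map_add' := map_add ι

theorem nakaH (hC : CommByFinite k A H ι) (h : A →ₐ[k] k) (S : Set H)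
    (hS : ∀ a : A, ∀ x ∈ Submodule.span k {x : H | ∃ (a : A), ∃ y ∈ S, x = ι a * y},
      ι a * x ∈ Submodule.span k {x : H | ∃ (a : A), ∃ y ∈ S, x = ι a * y})
    (hT : ∀ x : H, x ∈ rightMul k A H ι (RingHom.ker h) ⊔
      Submodule.span k {x : H | ∃ (a : A), ∃ y ∈ S, x = ι a * y}) :
    ∃ f : A, h f = 1 ∧ ∀ x : H, ι f * x ∈
      Submodule.span k {x : H | ∃ (a : A), ∃ y ∈ S, x = ι a * y} := by
  letI : Module A H := Module.compHom H (iR hC)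
  have sm : ∀ (a : A) (x : H), a • x = ι a * x := fun _ _ => rfl
  set N := Submodule.span k {x : H | ∃ (a : A), ∃ y ∈ S, x = ι a * y} with hN
  let NA : Submodule A H := 
    { carrier := N
      add_mem' := fun h1 h2 => N.add_mem h1 h2
      zero_mem' := N.zero_mem
      smul_mem' := fun a x hx => hS a x hx }
  obtain ⟨s, hs⟩ := hC.finiteOver
  have fin : Module.Finite A H := by
    refine ⟨⟨s, ?_⟩⟩
    rw [eq_top_iff]
    intro x _
    have hx : x ∈ Submodule.span k {x : H | ∃ (a : A), ∃ y ∈ s, x = ι a * y} := by rw [hs]; trivial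
    induction hx using Submodule.span_induction with
    | mem x hx =>
      obtain ⟨a, y, hy, rfl⟩ := hx
      exact Submodule.smul_mem _ a (Submodule.subset_span hy)
    | zero => exact zero_mem _
    | add x y _ _ h1 h2 => exact add_mem (h1 trivial) (h2 trivial)
    | smul c x _ h1 =>
      have : c • x = (algebraMap k A c) • x := by
        rw [sm, Algebra.algebraMap_eq_smul_one, map_smul, hC.ι_one, smul_one_mul]
      rw [this]
      exact Submodule.smul_mem _ _ (h1 trivial)
  have key := Submodule.exists_sub_one_mem_and_smul_eq_zero_of_fg_of_le_smul (RingHom.ker h)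
    (⊤ : Submodule A (H ⧸ NA)) Module.Finite.fg_top (by
      intro q _
      obtain ⟨x, rfl⟩ := Submodule.mkQ_surjective NA q
      have hx := hT x
      obtain ⟨y, hy, z, hz, rfl⟩ := Submodule.mem_sup.1 hx
      rw [map_add, show NA.mkQ z = 0 from (Submodule.Quotient.mk_eq_zero NA).2 hz, add_zero]
      clear hx
      induction hy using Submodule.span_induction with
      | mem x hx =>
        obtain ⟨y, a, ha, rfl⟩ := hx
        rw [← sm, map_smul]
        exact Submodule.smul_mem_smul ha trivial
      | zero => rw [map_zero]; exact zero_mem _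
      | add x y _ _ h1 h2 => rw [map_add]; exact add_mem (h1 trivial) (h2 trivial)
      | smul c x _ h1 =>
        have : c • x = (algebraMap k A c) • x := by
          rw [sm, Algebra.algebraMap_eq_smul_one, map_smul, hC.ι_one, smul_one_mul]
        rw [this, map_smul]
        exact Submodule.smul_mem _ _ (h1 trivial))
  obtain ⟨f, hf1, hf2⟩ := key
  refine ⟨f, ?_, fun x => ?_⟩
  · have : h (f - 1) = 0 := hf1
    rwa [map_sub, map_one, sub_eq_zero] at this
  · have := hf2 (NA.mkQ x) trivial
    rw [← map_smul] at this
    exact (Submodule.Quotient.mk_eq_zero NA).1 this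

theorem span_iota (hC : CommByFinite k A H ι) (S : Set H) :
   ∀ a : A, ∀ x ∈ Submodule.span k {x : H | ∃ (a : A), ∃ y ∈ S, x = ι a * y},
      ι a * x ∈ Submodule.span k {x : H | ∃ (a : A), ∃ y ∈ S, x = ι a * y} := by
  intro b x hx
  have : Submodule.span k {x : H | ∃ (a : A), ∃ y ∈ S, x = ι a * y} ≤
      (Submodule.span k {x : H | ∃ (a : A), ∃ y ∈ S, x = ι a * y}).comap (LinearMap.mulLeft k (ι b)) := by
    rw [Submodule.span_le]
    rintro _ ⟨a, y, hy, rfl⟩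
    exact Submodule.subset_span ⟨b * a, y, hy, by simp [hC.ι_mul, mul_assoc]⟩
  exact this hx

theorem right_ne_top (hC : CommByFinite k A H ι) (h : A →ₐ[k] k) :
    rightMul k A H ι (RingHom.ker h) ≠ ⊤ := by
  intro ht
  obtain ⟨f, hf, hf2⟩ := nakaH hC h ∅ (span_iota hC ∅) (by intro x; rw [ht]; simp)
  have := hf2 1
  simp at this
  have : f = 0 := hC.ι_inj (by rw [this, map_zero])
  rw [this, map_zero] at hf
  exact zero_ne_one hf

theorem dd_pos (hC : CommByFinite k A H ι) (h : A →ₐ[k] k) : dd k A H ι h ≠ 0 := by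
  have := fin_aux hC _ h le_rfl
  have h2 : Nontrivial (H ⧸ rightMul k A H ι (RingHom.ker h)) :=
    Submodule.Quotient.nontrivial_iff.2 (right_ne_top hC h)
  exact (Module.finrank_pos (R := k)).ne'

theorem semicont (hC : CommByFinite k A H ι) (g0 : A →ₐ[k] k) :
    ∃ f : A, g0 f = 1 ∧ ∀ g : A →ₐ[k] k, g f ≠ 0 → dd k A H ι g ≤ dd k A H ι g0 := by
  classical
  have := fin_aux hC _ g0 le_rfl
  set P := rightMul k A H ι (RingHom.ker g0) with hP
  let b := Module.finBasis k (H ⧸ P)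
  have := fun i => Submodule.mkQ_surjective P (b i)
  choose c hc using this
  obtain ⟨f, hf, hf2⟩ := nakaH hC g0 (Set.range c) (span_iota hC _) (by
    intro x
    have h1 : x - ∑ i, b.coord i (P.mkQ x) • c i ∈ P := by
      refine (Submodule.Quotient.mk_eq_zero _).1 ?_
      change P.mkQ _ = 0
      rw [map_sub, map_sum, sub_eq_zero]
      simp only [map_smul, hc]
      exact (b.sum_repr _).symm
    rw [show x = (x - ∑ i, b.coord i (P.mkQ x) • c i) + ∑ i, b.coord i (P.mkQ x) • c i by abel]
    refine add_mem (Submodule.mem_sup_left h1) (Submodule.mem_sup_right ?_)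
    exact sum_mem fun i _ => Submodule.smul_mem _ _
      (Submodule.subset_span ⟨1, c i, ⟨i, rfl⟩, by rw [hC.ι_one, one_mul]⟩))
  refine ⟨f, hf, fun g hg => ?_⟩
  let Pg := rightMul k A H ι (RingHom.ker g)
  have hmod : ∀ a x, Pg.mkQ (ι a * x) = g a • Pg.mkQ x := by
    intro a x
    rw [← map_smul, ← sub_eq_zero, ← map_sub, iota_sub hC]
    exact (Submodule.Quotient.mk_eq_zero Pg).2 (Submodule.subset_span ⟨x, _, sub_mem_ker g a, rfl⟩)
  have hsp : Submodule.span k (Set.range (Pg.mkQ ∘ c)) = ⊤ := by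
    rw [eq_top_iff]
    intro q _
    obtain ⟨x, rfl⟩ := Submodule.mkQ_surjective Pg q
    have h1 : Submodule.span k {x : H | ∃ (a : A), ∃ y ∈ Set.range c, x = ι a * y} ≤
      (Submodule.span k (Set.range (Pg.mkQ ∘ c))).comap Pg.mkQ := by
      rw [Submodule.span_le]
      rintro _ ⟨a, _, ⟨i, rfl⟩, rfl⟩
      rw [SetLike.mem_coe, Submodule.mem_comap, hmod]
      exact Submodule.smul_mem _ _ (Submodule.subset_span ⟨i, rfl⟩)
    have h2 := h1 (hf2 x)
    rw [Submodule.mem_comap, hmod] at h2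
    have h3 := Submodule.smul_mem _ (g f)⁻¹ h2
    rwa [smul_smul, inv_mul_cancel₀ hg, one_smul] at h3
  have h4 := finrank_range_le_card (R := k) (Pg.mkQ ∘ c)
  rw [Set.finrank, hsp, finrank_top, Fintype.card_fin] at h4
  exact h4

theorem row_sum (hC : CommByFinite k A H ι) (g : A →ₐ[k] k) (O : Finset (A →ₐ[k] k)) (J : Ideal A)
    (hJ : ∀ a, a ∈ J ↔ ∀ h ∈ O, h a = 0) (hst : ∀ h, ∀ a ∈ J, act hC h a ∈ J)
    (hJg : J ≤ RingHom.ker g) :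
    ∑ h ∈ O, nn k A H ι g h = dd k A H ι g := by
  have h1 := (crt_left hC O J hJ (rightMul k A H ι (RingHom.ker g))
    (fun x hx a => rightMul_mul hx _)).2 (fun h => fin_aux hC _ g le_sup_left)
  have h2 : rightMul k A H ι (RingHom.ker g) ⊔ leftMul k A H ι J = rightMul k A H ι (RingHom.ker g) := by
    rw [sup_eq_left, left_eq_right hC hst]; exact rightMul_mono hJg
  rw [h2] at h1
  exact h1.2.symm

theorem col_pos (hC : CommByFinite k A H ι) (h : A →ₐ[k] k) (O : Finset (A →ₐ[k] k)) (J : Ideal A)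
    (hJ : ∀ a, a ∈ J ↔ ∀ h ∈ O, h a = 0) (hst : ∀ h, ∀ a ∈ J, act hC h a ∈ J)
    (hh : h ∈ O) : ∃ g ∈ O, nn k A H ι g h ≠ 0 := by
  classical
  have hJh : J ≤ RingHom.ker h := fun a ha => (hJ a).1 ha h hh
  have hne : leftMul k A H ι (RingHom.ker h) ≠ ⊤ := by
    intro ht
    apply right_ne_top hC h
    obtain ⟨e, he1, he2⟩ := exists_idem O
    have h1 : leftMul k A H ι (RingHom.ker h) ≤ (leftMul k A H ι J).comap (LinearMap.mulRight k (ι (e h))) := by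
      conv_lhs => rw [leftMul]
      rw [Submodule.span_le]
      rintro _ ⟨x, a, ha, rfl⟩
      refine Submodule.subset_span ⟨x, a * e h, ?_, by simp [hC.ι_mul, mul_assoc]⟩
      rw [hJ]
      intro h' hh'
      rw [map_mul]
      by_cases hb : h = h'
      · subst hb
        rw [show h a = 0 from ha, zero_mul]
      · rw [he2 h h' hh' hb, mul_zero]
    rw [ht] at h1
    have h2 : (1 : H) * ι (e h) ∈ leftMul k A H ι J := h1 trivial
    rw [left_eq_right hC hst] at h2
    have h3 := rightMul_mono (k := k) (H := H) (ι := ι) hJh h2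
    have h4 : ι (1 - e h) * 1 ∈ rightMul k A H ι (RingHom.ker h) :=
      Submodule.subset_span ⟨1, 1 - e h, by rw [RingHom.mem_ker, map_sub, map_one, he1 h hh, sub_self], rfl⟩
    have h5 := add_mem h3 h4
    rw [one_mul, mul_one, ← map_add, add_sub_cancel, hC.ι_one] at h5
    rw [eq_top_iff]
    intro x _
    have := rightMul_mul h5 x
    rwa [one_mul] at this
  have h1 := (crt_right hC O J hJ (leftMul k A H ι (RingHom.ker h))
    (fun x hx a => mul_leftMul hx _)).2 (fun g => fin_aux hC _ g le_sup_right)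
  have h2 : leftMul k A H ι (RingHom.ker h) ⊔ rightMul k A H ι J = leftMul k A H ι (RingHom.ker h) := by
    rw [sup_eq_left, ← left_eq_right hC hst]; exact leftMul_mono hJh
  rw [h2] at h1
  obtain ⟨fd, h3⟩ := h1
  have nt : Nontrivial (H ⧸ leftMul k A H ι (RingHom.ker h)) := Submodule.Quotient.nontrivial_iff.2 hne
  have h4 := (Module.finrank_pos (R := k) (M := H ⧸ leftMul k A H ι (RingHom.ker h))).ne'
  rw [h3] at h4
  obtain ⟨g, hg, hg2⟩ := Finset.exists_ne_zero_of_sum_ne_zero h4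
  refine ⟨g, hg, ?_⟩
  rw [nn, sup_comm]
  exact hg2

theorem dd_const [IsAlgClosed k] [IsDomain A] (hC : CommByFinite k A H ι)
    (hcore : ∀ m : Ideal A, m.IsMaximal → IsCore k A H ι m (core m))
    (horb : OrbSemi A core) (h : A →ₐ[k] k) :
    dd k A H ι h = Module.finrank k (H ⧸ augHIdeal k A H ι) := by
  classical
  have hft := fintype_A hC
  set D := Module.finrank k (H ⧸ augHIdeal k A H ι) with hD
  obtain ⟨g0, hg0⟩ : ∃ g0 : A →ₐ[k] k, ∀ g, dd k A H ι g0 ≤ dd k A H ι g := by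
    have hex : ∃ n, ∃ g : A →ₐ[k] k, dd k A H ι g = n := ⟨_, h, rfl⟩
    obtain ⟨g0, hg0⟩ := Nat.find_spec hex
    exact ⟨g0, fun g => by rw [hg0]; exact Nat.find_min' hex ⟨g, rfl⟩⟩
  obtain ⟨f, hf1, hf2⟩ := semicont hC g0
  have hf0 : f ≠ 0 := by rintro rfl; simp at hf1
  obtain ⟨a, ha0, ha⟩ := exists_core_elt hC f hf0
  let I : Ideal A :=
    { carrier := {a | ∀ x : H, act hC x a ∈ Ideal.span {f}}
      add_mem' := fun {a b} h1 h2 x => by rw [act_add_right]; exact add_mem (h1 x) (h2 x)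
      zero_mem' := fun x => by rw [act_zero_right]; exact zero_mem _
      smul_mem' := fun c a h1 x => by
        rw [smul_eq_mul, act_mul_right]
        exact sw_mem ((Ideal.span {f}).restrictScalars k) _ _ fun u v =>
          Ideal.mul_mem_left _ _ (h1 v) }
  have hIst : ∀ x, ∀ a ∈ I, act hC x a ∈ I := by
    intro x a ha y
    rw [← act_mul_left]
    exact ha _
  obtain ⟨g, hga⟩ : ∃ g : A →ₐ[k] k, g a ≠ 0 := by
    by_contra hcon
    push Not at hcon
    have : IsJacobsonRing A := isJacobsonRing_of_finiteType (A := k)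
    have h1 : a ∈ Ideal.jacobson (⊥ : Ideal A) := by
      refine Ideal.mem_sInf.2 ?_
      rintro m ⟨-, hm⟩
      obtain ⟨g, rfl⟩ := nullst (k := k) m
      exact hcon g
    have h2 : Ideal.jacobson (⊥ : Ideal A) = ⊥ :=
      IsJacobsonRing.out inferInstance (Ideal.IsPrime.isRadical Ideal.isPrime_bot)
    rw [h2] at h1
    exact ha0 h1
  obtain ⟨O, hO1, hO2, hO3⟩ := exists_orb hC hcore horb g
  have hgO : g ∈ O := (hO1 g).2 rfl
  have hOf : ∀ h ∈ O, h f ≠ 0 := by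
    intro h hh hz
    have h1 : I ≤ RingHom.ker h := by
      intro b hb
      have := hb 1
      rw [act_one_left, Ideal.mem_span_singleton] at this
      obtain ⟨c, rfl⟩ := this
      rw [RingHom.mem_ker, map_mul, hz, zero_mul]
    have h2 := le_core hC hcore h hIst h1
    rw [(hO1 h).1 hh] at h2
    exact hga (core_le hcore g (h2 ha))
  have hr : ∀ h ∈ O, dd k A H ι h = dd k A H ι g0 := fun h hh =>
    le_antisymm (hf2 h (hOf h hh)) (hg0 h)
  have hst := core_stable hC hcore g
  have e1 := galois_count hC g O _ hO3 hst (core_le hcore g)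
  rw [Finset.sum_congr rfl (fun h hh => by rw [hr h hh]), ← Finset.sum_mul,
    row_sum hC g O _ hO3 hst (core_le hcore g)] at e1
  have hrD : dd k A H ι g0 = D := Nat.eq_of_mul_eq_mul_left (Nat.pos_of_ne_zero (dd_pos hC g)) e1
  clear hst e1 hr hOf hgO hO1 hO2 hO3 O
  obtain ⟨O, hO1, hO2, hO3⟩ := exists_orb hC hcore horb h
  have hst := core_stable hC hcore h
  obtain ⟨q, hq, hq2⟩ := col_pos hC h O _ hO3 hst ((hO1 h).2 rfl)
  have hJq := (hO2 q).1 hq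
  have e1 := galois_count hC q O _ hO3 hst hJq
  rw [← row_sum hC q O _ hO3 hst hJq, Finset.sum_mul] at e1
  have e2 := (Finset.sum_eq_sum_iff_of_le (fun i (hi : i ∈ O) => Nat.mul_le_mul_left
    (nn k A H ι q i) (hrD.symm.le.trans (hg0 i)))).1 e1.symm h ((hO1 h).2 rfl)
  exact (Nat.eq_of_mul_eq_mul_left (Nat.pos_of_ne_zero hq2) e2).symm

theorem part_iv [IsAlgClosed k] [IsDomain A] (hC : CommByFinite k A H ι)
    (hcore : ∀ m : Ideal A, m.IsMaximal → IsCore k A H ι m (core m))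
    (horb : OrbSemi A core) (g : A →ₐ[k] k) :
      Module.finrank k ↥(ghat k A H ι core g)
        = {m' : Ideal A | m'.IsMaximal ∧ core (RingHom.ker g) ≤ m'}.ncard
            * Module.finrank k (H ⧸ augHIdeal k A H ι) := by
  classical
  have hft := fintype_A hC
  obtain ⟨O, hO1, hO2, hO3⟩ := exists_orb hC hcore horb g
  obtain ⟨-, -, fd, h4⟩ := core_inf hC hcore g O hO3
  have h1 : Module.finrank k ↥(ghat k A H ι core g) =
      Module.finrank k (H ⧸ leftMul k A H ι (core (RingHom.ker g))) := by
    rw [ghat, ← (Submodule.dualQuotEquivDualAnnihilator _).finrank_eq, Subspace.dual_finrank_eq]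
  have h2 : {m' : Ideal A | m'.IsMaximal ∧ core (RingHom.ker g) ≤ m'} =
      ((O.image fun h => RingHom.ker h : Finset (Ideal A)) : Set (Ideal A)) := by
    ext m
    simp only [Set.mem_setOf_eq, Finset.coe_image, Set.mem_image, Finset.mem_coe]
    constructor
    · rintro ⟨hm, hle⟩
      obtain ⟨h, rfl⟩ := nullst (k := k) m
      exact ⟨h, (hO2 h).2 hle, rfl⟩
    · rintro ⟨h, hh, rfl⟩
      exact ⟨ker_max h, (hO2 h).1 hh⟩
  rw [h1, h2, Set.ncard_coe_finset, Finset.card_image_of_injective, h4]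
  · refine (Finset.sum_congr rfl fun h _ => dd_const hC hcore horb h).trans ?_
    rw [Finset.sum_const, smul_eq_mul]
  · intro h h' e
    exact ker_inj (le_of_eq e)

end Fib
end
end Paper


open Paper in
/-- Under (OrbSemi): (i) `k̂G_H` is a Hopf subalgebra of
`H°`; (ii) `ĝ·ĥ ⊆ Σ_{g'∼g, h'∼h} (g'h')^`; (iii) each `ĝ` is a left and right
`H̄*`-module. If `A` is a domain then (iv) `dim ĝ = |O_{m_g}|·dim H̄` and
(v) `ĝ = ⊕_{h∼g}(H/Hm_h)* = ⊕_{h∼g}(H/m_hH)*`. -/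
theorem statement_15
    (k : Type) [Field k] [IsAlgClosed k]
    (A : Type) [CommRing A] [HopfAlgebra k A]
    (H : Type) [Ring H] [HopfAlgebra k H]
    (ι : A →ₗ[k] H)
    (hCbF : CommByFinite k A H ι)
    (core : Ideal A → Ideal A)
    (hcore : ∀ m : Ideal A, m.IsMaximal → IsCore k A H ι m (core m))
    (horb : OrbSemi A core) :
    -- (i) `k̂G_H` is a Hopf subalgebra of `H°`
    charComp k A H ι core ⊆ finDual k H ∧
    convOne k ∈ charComp k A H ι core ∧
    (∀ f g, f ∈ charComp k A H ι core → g ∈ charComp k A H ι core →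
      f + g ∈ charComp k A H ι core ∧ conv k f g ∈ charComp k A H ι core) ∧
    (∀ (c : k), ∀ f ∈ charComp k A H ι core, c • f ∈ charComp k A H ι core) ∧
    (∀ f ∈ charComp k A H ι core,
      f ∘ₗ HopfAlgebra.antipode (R := k) ∈ charComp k A H ι core) ∧
    (∀ f ∈ charComp k A H ι core, ∃ (n : ℕ) (s t : Fin n → Module.Dual k H),
      (∀ i, s i ∈ charComp k A H ι core ∧ t i ∈ charComp k A H ι core) ∧
      ∀ x y : H, f (x * y) = ∑ i, s i x * t i y) ∧
    -- (ii) `ĝ ĥ ⊆ Σ_{g'∼g, h'∼h} (g'h')^`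
    (∀ g h : A →ₐ[k] k, ∀ f ∈ ghat k A H ι core g, ∀ f' ∈ ghat k A H ι core h,
      conv k f f' ∈ Submodule.span k
        {x : Module.Dual k H | ∃ g' h' c : A →ₐ[k] k,
          core (RingHom.ker g') = core (RingHom.ker g) ∧
          core (RingHom.ker h') = core (RingHom.ker h) ∧
          (∀ a : A, c a = conv k g'.toLinearMap h'.toLinearMap a) ∧
          x ∈ ghat k A H ι core c}) ∧
    -- (iii) each `ĝ` is a left and right `H̄*`-module
    (∀ (g : A →ₐ[k] k), ∀ t ∈ finDual k H ∩ hbarStar k A H ι,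
      ∀ f ∈ ghat k A H ι core g,
      conv k t f ∈ ghat k A H ι core g ∧ conv k f t ∈ ghat k A H ι core g) ∧
    -- (iv) if `A` is a domain, `dim_k ĝ = |O_{m_g}| · dim_k H̄`
    (IsDomain A → ∀ g : A →ₐ[k] k,
      Module.finrank k ↥(ghat k A H ι core g)
        = {m' : Ideal A | m'.IsMaximal ∧ core (RingHom.ker g) ≤ m'}.ncard
            * Module.finrank k (H ⧸ augHIdeal k A H ι)) ∧
    -- (v) if `A` is a domain, `ĝ = ⊕_{h∼g}(H/Hm_h)* = ⊕_{h∼g}(H/m_hH)*`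
    (IsDomain A → ∀ g : A →ₐ[k] k,
      ghat k A H ι core g
        = ⨆ h : {h : A →ₐ[k] k // core (RingHom.ker h) = core (RingHom.ker g)},
            (leftMul k A H ι (RingHom.ker h.1)).dualAnnihilator ∧
      ghat k A H ι core g
        = ⨆ h : {h : A →ₐ[k] k // core (RingHom.ker h) = core (RingHom.ker g)},
            (rightMul k A H ι (RingHom.ker h.1)).dualAnnihilator) := by
  obtain ⟨a1, a2, a3, a4, a5, a6⟩ := part_i hCbF hcore horb
  exact ⟨a1, a2, a3, a4, a5, a6,
    fun g h f hf f' hf' => part_ii hCbF hcore horb g h f f' hf hf',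
    fun g t ht f hf => part_iii hCbF g t f ht.2 hf,
    fun _ g => part_iv hCbF hcore horb g,
    fun _ g => part_v hCbF hcore horb g⟩
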